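/- arXiv:2002.04713 — 2 statements merged into one kernel-verified Lean document; each statement's English description precedes it below -/
import Mathlib

section
/- Let X ⊂ ℙ^n be any smooth complete intersection of s hypersurfaces of degrees d_1, …, d_s with d := d_1 + ⋯ + d_s. Then every nonempty irreducible component of the Fano variety of lines F(X) has dimension at least 2n − d − s − 2; moreover, if 2n − d − s − 2 ≥ 0 then F(X) is nonempty, so dim F(X) ≥ 2n − d − s − 2. -/
/-! Formalization of: for a smooth complete intersection X ⊆ ℙ^n of s hypersurfaces of
degrees d_1,…,d_s with d := Σ d_i, every nonempty irreducible component of F(X) has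
dimension at least 2n − d − s − 2; moreover if 2n − d − s − 2 ≥ 0 then F(X) is nonempty,
so dim F(X) ≥ 2n − d − s − 2. -/

noncomputable section

/-- The Zariski topology on complex projective `n`-space `ℙ(ℂ^{n+1})`: it is generated by the
complements of the zero loci of homogeneous polynomials. -/
instance projZariski (n : ℕ) : TopologicalSpace (Projectivization ℂ (Fin (n + 1) → ℂ)) :=
  TopologicalSpace.generateFrom
    {U | ∃ (k : ℕ) (f : MvPolynomial (Fin (n + 1)) ℂ), f.IsHomogeneous k ∧
      U = {x | MvPolynomial.eval x.rep f ≠ 0}}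

/-- The Grassmannian `G(1,n)` of projective lines in `ℙ^n`, i.e. the set of 2-dimensional
linear subspaces of `ℂ^{n+1}`. -/
def ProjLine (n : ℕ) : Type :=
  {W : Submodule ℂ (Fin (n + 1) → ℂ) // Module.finrank ℂ W = 2}

/-- The Zariski topology on the Grassmannian of lines: it is generated by the complements of
the loci of lines `ℙ(W)` on which a fixed polynomial in two vector arguments vanishes
identically on `W × W` (e.g. polynomials in the Plücker coordinates). -/
instance grassZariski (n : ℕ) : TopologicalSpace (ProjLine n) :=
  TopologicalSpace.generateFrom
    {U | ∃ F : MvPolynomial (Fin (n + 1) ⊕ Fin (n + 1)) ℂ,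
      U = {W : ProjLine n | ¬ ∀ u ∈ W.1, ∀ v ∈ W.1, MvPolynomial.eval (Sum.elim u v) F = 0}}

/-- The projective line `ℙ(W) ⊆ ℙ^n` associated to a linear subspace `W ⊆ ℂ^{n+1}`,
as a set of points of `ℙ^n`. -/
def lineSet {n : ℕ} (W : Submodule ℂ (Fin (n + 1) → ℂ)) :
    Set (Projectivization ℂ (Fin (n + 1) → ℂ)) :=
  {x | x.rep ∈ W}

/-- The Fano variety of lines of `X ⊆ ℙ^n`: the subset of the Grassmannian of lines
consisting of the lines contained in `X`. -/
def fanoLines {n : ℕ} (X : Set (Projectivization ℂ (Fin (n + 1) → ℂ))) : Set (ProjLine n) :=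
  {W | lineSet W.1 ⊆ X}

/-- `X ⊆ ℙ^n` is a smooth complete intersection of the `s` hypersurfaces of degrees
`d 0, …, d (s-1)` cut out by the homogeneous polynomials `f 0, …, f (s-1)`:  each `f i` is
homogeneous of degree `d i ≥ 2`, `X` is the common zero locus of the `f i`, `X` has
codimension `s` (i.e. dimension `n - s`), and the Jacobian matrix `(∂f_i/∂x_j)` has rank `s`
at every point of (the affine cone over) `X`. -/
structure IsSmoothCI (n s : ℕ) (d : Fin s → ℕ) (f : Fin s → MvPolynomial (Fin (n + 1)) ℂ)
    (X : Set (Projectivization ℂ (Fin (n + 1) → ℂ))) : Prop where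
  two_le_deg : ∀ i, 2 ≤ d i
  homog : ∀ i, (f i).IsHomogeneous (d i)
  locus : X = {x | ∀ i, MvPolynomial.eval x.rep (f i) = 0}
  codim : topologicalKrullDim ↥X = ((n - s : ℕ) : WithBot ℕ∞)
  smooth : ∀ v : Fin (n + 1) → ℂ, v ≠ 0 → (∀ i, MvPolynomial.eval v (f i) = 0) →
    (Matrix.of fun i j => MvPolynomial.eval v (MvPolynomial.pderiv j (f i))).rank = s

section PartA
open MvPolynomial in
def translEquiv {σ : Type} (c : σ → ℂ) : MvPolynomial σ ℂ ≃ₐ[ℂ] MvPolynomial σ ℂ :=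
  AlgEquiv.ofAlgHom (aeval fun i => X i + C (c i)) (aeval fun i => X i - C (c i))
    (by ext i; simp) (by ext i; simp)

open MvPolynomial in
lemma height_point {σ : Type} [Finite σ] (a : σ → ℂ) :
    (Nat.card σ : ℕ∞) ≤ (vanishingIdeal ℂ ({a} : Set (σ → ℂ))).height := by
  have h1 : ringKrullDim (MvPolynomial σ ℂ) = Nat.card σ := by
    rw [MvPolynomial.ringKrullDim_of_isNoetherianRing]; simp
  have h2 : ringKrullDim (MvPolynomial σ ℂ) ≤
      ((vanishingIdeal ℂ ({a} : Set (σ → ℂ))).height : WithBot ℕ∞) := by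
    rw [ringKrullDim_le_iff_isMaximal_height_le]
    intro m hm
    obtain ⟨x, rfl⟩ := eq_vanishingIdeal_singleton_of_isMaximal ℂ hm
    have : vanishingIdeal ℂ ({x} : Set (σ → ℂ)) =
        (vanishingIdeal ℂ ({a} : Set (σ → ℂ))).comap
          (translEquiv (x - a)).toRingEquiv := by
      ext p
      simp only [mem_vanishingIdeal_singleton_iff, Ideal.mem_comap]
      have : (aeval (R := ℂ) a).comp (translEquiv (x - a)).toAlgHom = aeval x := by
        ext i; simp [translEquiv]
      rw [← this]; rfl
    rw [this, RingEquiv.height_comap]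
  rw [h1] at h2
  exact_mod_cast h2

open MvPolynomial in
/-- Points of the zero locus of a prime avoiding a polynomial outside of the prime. -/
lemma exists_point_of_notMem {σ : Type} [Finite σ] (p : Ideal (MvPolynomial σ ℂ)) [p.IsPrime]
    {h : MvPolynomial σ ℂ} (hh : h ∉ p) : ∃ a : σ → ℂ, (∀ g ∈ p, eval a g = 0) ∧ eval a h ≠ 0 := by
  by_contra! hc
  apply hh
  rw [← IsPrime.vanishingIdeal_zeroLocus (K := ℂ) p]
  intro x hx
  have := hc x (fun g hg => by simpa using hx g hg)
  simpa using this

open MvPolynomial in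
lemma exists_chain {σ : Type} [Finite σ] (S : Set (MvPolynomial σ ℂ)) (D : ℕ) (hS : S.encard ≤ D)
    (p : Ideal (MvPolynomial σ ℂ)) (hp : p ∈ (Ideal.span S).minimalPrimes) :
    ∃ l : LTSeries (PrimeSpectrum (MvPolynomial σ ℂ)), p ≤ l.head.asIdeal ∧
      Nat.card σ ≤ l.length + D := by
  classical
  set I := Ideal.span S with hI
  have hpp : p.IsPrime := hp.1.1
  have hfin : I.minimalPrimes.Finite := Ideal.finite_minimalPrimes_of_isNoetherianRing _ _
  -- a polynomial in all other minimal primes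
  obtain ⟨h, hhp, hh⟩ : ∃ h, h ∉ p ∧ ∀ q ∈ I.minimalPrimes, q ≠ p → h ∈ q := by
    by_contra! hc
    let T := hfin.toFinset.erase p
    have hle : T.inf id ≤ p := by
      intro h hh
      by_contra hn
      obtain ⟨q, hq, hqp, hq'⟩ := hc h hn
      exact hq' ((Finset.inf_le (f := id) (s := T) (b := q) (by simp [T, hq, hqp])) hh)
    rw [Ideal.IsPrime.inf_le' hpp] at hle
    obtain ⟨q, hq, hqp⟩ := hle
    simp only [T, Finset.mem_erase, Set.Finite.mem_toFinset] at hq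
    exact hq.1 (le_antisymm hqp (hp.2 hq.2.1 hqp))
  obtain ⟨a, ha, hah⟩ := exists_point_of_notMem p hhp
  set m := vanishingIdeal ℂ ({a} : Set (σ → ℂ)) with hm
  have hpm : p ≤ m := fun g hg => by
    rw [hm, mem_vanishingIdeal_singleton_iff]; simpa using ha g hg
  have hIm : I ≤ m := hp.1.2.trans hpm
  have hSm : S ⊆ m := fun x hx => hIm (Ideal.subset_span hx)
  have key := (height_point a).trans (Ideal.height_le_height_add_encard_of_subset S hSm)
  have : (Ideal.map (Ideal.Quotient.mk I) m).IsPrime :=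
      Ideal.isPrime_map_quotientMk_of_isPrime hIm
  obtain ⟨l, hl1, hl2⟩ := Ideal.exists_ltSeries_length_eq_height (Ideal.map (Ideal.Quotient.mk I) m)
  have hsm : StrictMono (PrimeSpectrum.comap (Ideal.Quotient.mk I)) := by
    apply Monotone.strictMono_of_injective
    · intro x y hxy
      exact Ideal.comap_mono hxy
    · exact PrimeSpectrum.comap_injective_of_surjective _ Ideal.Quotient.mk_surjective
  refine ⟨l.map _ hsm, ?_, ?_⟩
  · have h1 : I ≤ (PrimeSpectrum.comap (Ideal.Quotient.mk I) l.head).asIdeal := by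
      intro x hx
      simp [Ideal.Quotient.eq_zero_iff_mem.mpr hx]
    obtain ⟨q, hq, hqle⟩ := Ideal.exists_minimalPrimes_le h1
    have h2 : (PrimeSpectrum.comap (Ideal.Quotient.mk I) l.head).asIdeal ≤ m := by
      have h3 : l.head.asIdeal ≤ Ideal.map (Ideal.Quotient.mk I) m := by
        have := LTSeries.head_le_last l
        rw [hl1] at this
        exact this
      intro x hx
      have := h3 hx
      rwa [Ideal.mem_quotient_iff_mem hIm] at this
    by_cases hqp : q = p
    · subst hqp; exact hqle
    · exfalso
      have := h2 (hqle (hh q hq hqp))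
      rw [hm, mem_vanishingIdeal_singleton_iff] at this
      exact hah (by simpa using this)
  · rw [← hl2] at key
    have := key.trans (add_le_add_right hS _)
    simp only [LTSeries.map_length]
    exact_mod_cast this
end PartA

section PartB
open MvPolynomial in
/-- High powers of the variables: a homogeneous polynomial of large degree lies in an ideal
containing powers of all the variables. -/
lemma homog_mem_of_pow_mem {σ : Type} [Fintype σ] (J : Ideal (MvPolynomial σ ℂ)) (M : ℕ)
    (hM : ∀ i, (X i : MvPolynomial σ ℂ) ^ M ∈ J) (g : MvPolynomial σ ℂ)
    (hg : g.IsHomogeneous (Fintype.card σ * M + 1)) : g ∈ J := by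
  classical
  rw [g.as_sum]
  refine J.sum_mem fun e he => ?_
  have hdeg := hg (mem_support_iff.mp he)
  obtain ⟨i, hi⟩ : ∃ i, M ≤ e i := by
    by_contra! hc
    have h1 : ∑ i, e i ≤ ∑ i : σ, M := Finset.sum_le_sum fun i _ => (hc i).le
    have h2 : Finsupp.weight 1 e = ∑ i, e i := by
      rw [Finsupp.weight_apply, Finsupp.sum_fintype] <;> simp
    simp at h1
    omega
  have : monomial e (coeff e g) = monomial (e - Finsupp.single i M) (coeff e g) * X i ^ M := by
    rw [X_pow_eq_monomial, monomial_mul, mul_one, tsub_add_cancel_of_le]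
    simpa using hi
  rw [this]
  exact J.mul_mem_left _ (hM i)

open MvPolynomial in
lemma homogComp_mul {σ : Type} (c B : MvPolynomial σ ℂ) (e m : ℕ) (hB : B.IsHomogeneous e) :
    homogeneousComponent m (c * B) =
      if e ≤ m then homogeneousComponent (m - e) c * B else 0 := by
  conv_lhs => rw [← sum_homogeneousComponent c, Finset.sum_mul, map_sum]
  have h1 : ∀ i, homogeneousComponent m (homogeneousComponent i c * B) =
      if m = i + e then homogeneousComponent i c * B else 0 := fun i =>
    homogeneousComponent_of_mem ((homogeneousComponent_isHomogeneous i c).mul hB)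
  simp only [h1]
  split_ifs with h
  · rw [Finset.sum_eq_single (m - e)]
    · rw [if_pos (by omega)]
    · intro b _ hb; rw [if_neg (by omega)]
    · intro hn
      rw [if_pos (by omega), homogeneousComponent_eq_zero, zero_mul]
      simp at hn; omega
  · exact Finset.sum_eq_zero fun i _ => if_neg (by omega)

open MvPolynomial in
lemma span_homog {σ ι : Type} (B : ι → MvPolynomial σ ℂ) (e : ι → ℕ)
    (hB : ∀ k, (B k).IsHomogeneous (e k)) (m : ℕ) (g : MvPolynomial σ ℂ)
    (hg : g.IsHomogeneous m) (hgJ : g ∈ Ideal.span (Set.range B)) :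
    g ∈ Submodule.span ℂ {x | ∃ (k : ι) (c : MvPolynomial σ ℂ),
      e k ≤ m ∧ c.IsHomogeneous (m - e k) ∧ x = c * B k} := by
  classical
  obtain ⟨c, rfl⟩ := Finsupp.mem_span_range_iff_exists_finsupp.mp hgJ
  rw [← homogeneousComponent_eq_self hg, Finsupp.sum, map_sum]
  refine Submodule.sum_mem _ fun k _ => ?_
  rw [smul_eq_mul, homogComp_mul _ _ _ _ (hB k)]
  split_ifs with h
  · exact Submodule.subset_span ⟨k, _, h, homogeneousComponent_isHomogeneous _ _, rfl⟩
  · simp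

lemma finite_not_span {V K : Type} [AddCommGroup V] [Module ℂ V] [FiniteDimensional ℂ V]
    (w0 w1 : K → V) (h1 : Submodule.span ℂ (Set.range w1) = ⊤) :
    {t : ℂ | Submodule.span ℂ (Set.range fun k => (1 - t) • w0 k + t • w1 k) ≠ ⊤}.Finite := by
  classical
  obtain ⟨κ, a, -, hspan, hli⟩ := exists_linearIndependent' ℂ w1
  have : Finite κ := hli.finite
  have : Fintype κ := Fintype.ofFinite κ
  let b := Module.Basis.mk hli (by rw [hspan, h1])
  let P : Matrix κ κ (Polynomial ℂ) := Matrix.of fun r s =>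
    (1 - Polynomial.X) * Polynomial.C (b.repr (w0 (a s)) r) + Polynomial.X * Polynomial.C (b.repr (w1 (a s)) r)
  have hP : ∀ t, P.det.eval t = b.det (fun k => (1 - t) • w0 (a k) + t • w1 (a k)) := by
    intro t
    rw [Module.Basis.det_apply, ← Polynomial.coe_evalRingHom, RingHom.map_det]
    congr 1
    ext r s
    simp [P, Module.Basis.toMatrix_apply, mul_comm t]
  have hP1 : P.det.eval 1 = 1 := by
    rw [hP]
    have : (fun k => (1 - (1:ℂ)) • w0 (a k) + (1:ℂ) • w1 (a k)) = b := by
      ext k; simp [b]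
    rw [this, Module.Basis.det_self]
  have hP0 : P.det ≠ 0 := by
    intro h; rw [h] at hP1; simp at hP1
  refine (P.det.roots.toFinset.finite_toSet).subset ?_
  intro t ht
  simp only [Finset.mem_coe, Multiset.mem_toFinset, Polynomial.mem_roots hP0, Polynomial.IsRoot]
  by_contra hne
  apply ht
  have := ((Module.Basis.is_basis_iff_det b (v := fun k => (1 - t) • w0 (a k) + t • w1 (a k))).mpr
    (by rw [← hP]; exact isUnit_iff_ne_zero.mpr hne)).2
  rw [eq_top_iff, ← this]
  apply Submodule.span_mono
  rintro _ ⟨k, rfl⟩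
  exact ⟨a k, rfl⟩

open MvPolynomial in
/-- Elimination theory for a pencil of homogeneous systems. -/
lemma elimination {σ ι : Type} [Fintype σ] (A B : ι → MvPolynomial σ ℂ) (e : ι → ℕ)
    (hA : ∀ k, (A k).IsHomogeneous (e k)) (hB : ∀ k, (B k).IsHomogeneous (e k))
    (h1 : ∀ x : σ → ℂ, (∀ k, eval x (B k) = 0) → x = 0) :
    {t : ℂ | ∃ x : σ → ℂ, x ≠ 0 ∧ ∀ k, (1 - t) * eval x (A k) + t * eval x (B k) = 0}.Finite := by
  classical
  set J := Ideal.span (Set.range B) with hJ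
  have hrad : ∀ i, (X i : MvPolynomial σ ℂ) ∈ J.radical := by
    intro i
    rw [← vanishingIdeal_zeroLocus_eq_radical (K := ℂ)]
    intro x hx
    have : x = 0 := h1 x fun k => by simpa using hx (B k) (Ideal.subset_span ⟨k, rfl⟩)
    simp [this]
  choose M hM using hrad
  let M' := ∑ i, M i
  have hM' : ∀ i, (X i : MvPolynomial σ ℂ) ^ M' ∈ J := fun i =>
    Ideal.pow_mem_of_pow_mem _ (hM i) (Finset.single_le_sum (f := M) (fun _ _ => Nat.zero_le _) (Finset.mem_univ i))
  set m := Fintype.card σ * M' + 1 with hm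
  let V := homogeneousSubmodule σ ℂ m
  have hVle : V ≤ restrictTotalDegree σ ℂ m := by
    intro x hx
    rw [mem_restrictTotalDegree]
    exact IsHomogeneous.totalDegree_le hx
  have : FiniteDimensional ℂ V := Submodule.finiteDimensional_of_le hVle
  let K := {kc : ι × MvPolynomial σ ℂ // e kc.1 ≤ m ∧ kc.2.IsHomogeneous (m - e kc.1)}
  have hmem : ∀ (F : ι → MvPolynomial σ ℂ) (_ : ∀ k, (F k).IsHomogeneous (e k)) (z : K),
      z.1.2 * F z.1.1 ∈ V := by
    intro F hF z
    have := z.2.2.mul (hF z.1.1)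
    rwa [Nat.sub_add_cancel z.2.1] at this
  let w0 : K → V := fun z => ⟨z.1.2 * A z.1.1, hmem A hA z⟩
  let w1 : K → V := fun z => ⟨z.1.2 * B z.1.1, hmem B hB z⟩
  have hspan : Submodule.span ℂ (Set.range w1) = ⊤ := by
    rw [eq_top_iff]
    rintro ⟨g, hg⟩ -
    have := span_homog B e hB m g hg (homog_mem_of_pow_mem J M' hM' g hg)
    have himg : {x | ∃ (k : ι) (c : MvPolynomial σ ℂ),
      e k ≤ m ∧ c.IsHomogeneous (m - e k) ∧ x = c * B k} ⊆ V.subtype '' (Set.range w1) := by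
      rintro _ ⟨k, c, h1, h2, rfl⟩
      exact ⟨_, ⟨⟨(k, c), h1, h2⟩, rfl⟩, rfl⟩
    have h3 := Submodule.span_mono himg this
    rw [← Submodule.map_span] at h3
    obtain ⟨y, hy, hy2⟩ := h3
    have : y = ⟨g, hg⟩ := Subtype.ext hy2
    rwa [← this]
  refine (finite_not_span w0 w1 hspan).subset ?_
  rintro t ⟨x, hx0, hx⟩ htop
  apply hx0
  let ev : V →ₗ[ℂ] ℂ := (aeval (R := ℂ) x).toLinearMap.comp V.subtype
  have hev : ∀ v ∈ Submodule.span ℂ (Set.range fun k => (1 - t) • w0 k + t • w1 k), ev v = 0 := by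
    intro v hv
    induction hv using Submodule.span_induction with
    | zero => simp
    | add x y _ _ hx hy => rw [map_add, hx, hy, add_zero]
    | smul a x _ hx => rw [map_smul, hx, smul_zero]
    | mem v hv =>
      obtain ⟨z, rfl⟩ := hv
      have := hx z.1.1
      simp only [ev, w0, w1, LinearMap.comp_apply, Submodule.subtype_apply, Submodule.coe_add,
        Submodule.coe_smul, AlgHom.toLinearMap_apply, map_add, map_smul, map_mul, smul_eq_mul,
        ← coe_aeval_eq_eval, RingHom.coe_coe] at this ⊢
      linear_combination (aeval x z.1.2) * this
  ext i
  have h4 := hev ⟨X i ^ m, by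
    have := (isHomogeneous_X ℂ i).pow m
    rw [one_mul] at this
    exact this⟩ (by rw [htop]; trivial)
  have h5 : x i ^ m = 0 := by simpa [ev] using h4
  exact pow_eq_zero_iff (by omega) |>.mp h5
end PartB

section PartC
lemma single_mem_of {P : Type} [Fintype P] [DecidableEq P] (S : Submodule ℂ (P → ℂ)) (v : P → ℂ)
    (hv : v ∈ S) (p : P) (hp : v p ≠ 0)
    (h : ∀ p', p' ≠ p → v p' ≠ 0 → Pi.single p' (1:ℂ) ∈ S) : Pi.single p (1:ℂ) ∈ S := by
  have h1 : v = v p • Pi.single p (1:ℂ) + ∑ p' ∈ Finset.univ.erase p, v p' • Pi.single p' (1:ℂ) := by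
    rw [Finset.add_sum_erase _ (fun p' => v p' • (Pi.single p' (1:ℂ) : P → ℂ)) (Finset.mem_univ p)]
    ext q
    simp [Finset.sum_apply, Pi.single_apply]
  have h2 : ∑ p' ∈ Finset.univ.erase p, v p' • (Pi.single p' (1:ℂ) : P → ℂ) ∈ S := by
    refine S.sum_mem fun p' hp' => ?_
    by_cases h0 : v p' = 0
    · rw [h0, zero_smul]; exact S.zero_mem
    · exact S.smul_mem _ (h p' (Finset.ne_of_mem_erase hp') h0)
  have h3 : v p • (Pi.single p (1:ℂ) : P → ℂ) ∈ S := by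
    have := S.sub_mem hv h2
    rw [h1] at this
    simpa [Pi.single_apply] using this
  have := S.smul_mem (v p)⁻¹ h3
  rwa [smul_smul, inv_mul_cancel₀ hp, one_smul] at this

/-- The offset of block `i`. -/
def blkOff {s : ℕ} (d : Fin s → ℕ) (i : Fin s) : ℕ := ∑ i' ∈ Finset.Iio i, (d i' + 1)

lemma blkOff_lt {s : ℕ} (d : Fin s → ℕ) {i i' : Fin s} (h : i < i') :
    blkOff d i + d i + 1 ≤ blkOff d i' := by
  have : insert i (Finset.Iio i) ⊆ Finset.Iio i' := by
    intro x hx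
    simp only [Finset.mem_insert, Finset.mem_Iio] at hx ⊢
    rcases hx with rfl | hx
    · exact h
    · exact hx.trans h
  have := Finset.sum_le_sum_of_subset (f := fun i' => d i' + 1) this
  rw [Finset.sum_insert (by simp)] at this
  unfold blkOff
  omega

lemma blkOff_le {s : ℕ} (d : Fin s → ℕ) (i : Fin s) :
    blkOff d i + d i + 1 ≤ ∑ i, d i + s := by
  have : insert i (Finset.Iio i) ⊆ Finset.univ := Finset.subset_univ _
  have := Finset.sum_le_sum_of_subset (f := fun i' => d i' + 1) this
  rw [Finset.sum_insert (by simp)] at this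
  have h2 : ∑ i, (d i + 1) = ∑ i, d i + s := by simp [Finset.sum_add_distrib]
  unfold blkOff
  omega

/-- The support pattern of the special system. -/
def spCond {s : ℕ} (d : Fin s → ℕ) (i : Fin s) (k j : ℕ) : Prop :=
  blkOff d i ≤ 2 * k + 1 ∧ 2 * k ≤ blkOff d i + d i ∧
    (j = min (2 * k - blkOff d i) (d i - 1) ∨ j = min (2 * k - blkOff d i) (d i - 1) + 1)

lemma range_top_of_cond {s N : ℕ} (d : Fin s → ℕ) (hd : ∀ i, 2 ≤ d i)
    (hN : ∑ i, d i + s ≤ 2 * N) (Q : Fin s → ℕ → ℕ → ℂ)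
    (hQ : ∀ i k j, j ≤ d i → (Q i k j ≠ 0 ↔ spCond d i k j))
    (S : Submodule ℂ ((Σ i, Fin (d i + 1)) → ℂ))
    (hS : ∀ k < N, ∀ α β : ℂ, (fun p => (α + β * (p.2 : ℕ)) * Q p.1 k p.2) ∈ S) : S = ⊤ := by
  classical
  have hdis : ∀ i i', i ≠ i' → blkOff d i + d i + 1 ≤ blkOff d i' ∨
      blkOff d i' + d i' + 1 ≤ blkOff d i := by
    intro i i' h
    rcases lt_or_gt_of_ne h with h | h
    · exact Or.inl (blkOff_lt d h)
    · exact Or.inr (blkOff_lt d h)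
  have hE : ∀ (i : Fin s) (j : ℕ) (hj : j < d i + 1), (blkOff d i + j) % 2 = 0 → j < d i →
      (Pi.single (⟨i, ⟨j, hj⟩⟩ : Σ i, Fin (d i + 1)) (1:ℂ)) ∈ S := by
    intro i j hj hm hjd
    have hle := blkOff_le d i
    refine single_mem_of S _ (hS ((blkOff d i + j) / 2) (by omega) (j + 1) (-1)) _ ?_ ?_
    · have := (hQ i ((blkOff d i + j) / 2) j (by omega)).mpr ⟨by omega, by omega, by omega⟩
      simpa using this
    · rintro ⟨i', j', hj'⟩ hne h0
      exfalso
      have hq := (hQ i' _ j' (by omega)).mp (right_ne_zero_of_mul h0)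
      have hl := left_ne_zero_of_mul h0
      obtain ⟨h1, h2, h3⟩ := hq
      by_cases hi : i' = i
      · subst hi
        have h5 : j' ≠ j := by rintro rfl; exact hne rfl
        have h6 : j' ≠ j + 1 := by rintro rfl; apply hl; push_cast; ring
        omega
      · have := hdis _ _ hi
        omega
  have hO : ∀ (i : Fin s) (j : ℕ) (hj : j < d i + 1), (blkOff d i + j) % 2 = 1 → 0 < j →
      (Pi.single (⟨i, ⟨j, hj⟩⟩ : Σ i, Fin (d i + 1)) (1:ℂ)) ∈ S := by
    intro i j hj hm hjd
    have hle := blkOff_le d i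
    obtain ⟨j, rfl⟩ : ∃ j₀, j = j₀ + 1 := ⟨j - 1, by omega⟩
    refine single_mem_of S _ (hS ((blkOff d i + j) / 2) (by omega) (-j) (1)) _ ?_ ?_
    · have := (hQ i ((blkOff d i + j) / 2) (j + 1) (by omega)).mpr ⟨by omega, by omega, by omega⟩
      simpa using this
    · rintro ⟨i', j', hj'⟩ hne h0
      exfalso
      have hq := (hQ i' _ j' (by omega)).mp (right_ne_zero_of_mul h0)
      have hl := left_ne_zero_of_mul h0
      obtain ⟨h1, h2, h3⟩ := hq
      by_cases hi : i' = i
      · subst hi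
        have h5 : j' ≠ j + 1 := by rintro rfl; exact hne rfl
        have h6 : j' ≠ j := by rintro rfl; apply hl; push_cast; ring
        omega
      · have := hdis _ _ hi
        omega
  have hL : ∀ (i : Fin s),
      (Pi.single (⟨i, ⟨d i, Nat.lt_succ_self _⟩⟩ : Σ i, Fin (d i + 1)) (1:ℂ)) ∈ S := by
    intro i
    have hdi := hd i
    rcases Nat.mod_two_eq_zero_or_one (blkOff d i + d i) with hm | hm
    swap
    · exact hO i _ _ hm (by omega)
    have hle := blkOff_le d i
    refine single_mem_of S _ (hS ((blkOff d i + d i) / 2) (by omega) 0 1) _ ?_ ?_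
    · have := (hQ i ((blkOff d i + d i) / 2) (d i) (by omega)).mpr ⟨by omega, by omega, by omega⟩
      have h2 : d i ≠ 0 := by omega
      simpa using ⟨h2, this⟩
    · rintro ⟨i', j', hj'⟩ hne h0
      have hdi' := hd i'
      have hq := (hQ i' _ j' (by omega)).mp (right_ne_zero_of_mul h0)
      have hl := left_ne_zero_of_mul h0
      obtain ⟨h1, h2, h3⟩ := hq
      by_cases hi : i' = i
      · subst hi
        have h5 : j' ≠ d i' := by rintro rfl; exact hne rfl
        exact hO _ _ _ (by omega) (by omega)
      · have := hdis _ _ hi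
        have h5 : j' ≠ 0 := by rintro rfl; simp at hl
        exact hE _ _ _ (by omega) (by omega)
  have hF : ∀ (i : Fin s),
      (Pi.single (⟨i, ⟨0, Nat.succ_pos _⟩⟩ : Σ i, Fin (d i + 1)) (1:ℂ)) ∈ S := by
    intro i
    have hdi := hd i
    rcases Nat.mod_two_eq_zero_or_one (blkOff d i + 0) with hm | hm
    · exact hE i _ _ hm (by omega)
    have hle := blkOff_le d i
    refine single_mem_of S _ (hS ((blkOff d i) / 2) (by omega) 1 0) _ ?_ ?_
    · have := (hQ i ((blkOff d i) / 2) 0 (by omega)).mpr ⟨by omega, by omega, by omega⟩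
      simpa using this
    · rintro ⟨i', j', hj'⟩ hne h0
      have hdi' := hd i'
      have hq := (hQ i' _ j' (by omega)).mp (right_ne_zero_of_mul h0)
      obtain ⟨h1, h2, h3⟩ := hq
      by_cases hi : i' = i
      · subst hi
        have h5 : j' ≠ 0 := by rintro rfl; exact hne rfl
        exact hE _ _ _ (by omega) (by omega)
      · have := hdis _ _ hi
        by_cases h6 : j' = d i'
        · subst h6; exact hL i'
        · exact hO _ _ _ (by omega) (by omega)
  have hall : ∀ p : Σ i, Fin (d i + 1), Pi.single p (1:ℂ) ∈ S := by
    rintro ⟨i, j, hj⟩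
    by_cases h0 : j = 0
    · subst h0; exact hF i
    by_cases h1 : j = d i
    · subst h1; exact hL i
    rcases Nat.mod_two_eq_zero_or_one (blkOff d i + j) with hm | hm
    · exact hE _ _ _ hm (by omega)
    · exact hO _ _ _ hm (by omega)
  rw [eq_top_iff]
  intro v _
  have : v = ∑ p, v p • (Pi.single p (1:ℂ) : (Σ i, Fin (d i + 1)) → ℂ) := by
    ext q; simp [Finset.sum_apply, Pi.single_apply]
  rw [this]
  exact S.sum_mem fun p _ => S.smul_mem _ (hall p)

/-- The point with parameter `t` on the standard line with chart coordinate `a`. -/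
def stdPt {N : ℕ} (a : Fin 2 → Fin N → ℂ) (t : ℂ) : Fin (N + 2) → ℂ :=
  Fin.cons 1 (Fin.cons t fun k => a 0 k + t * a 1 k)

open MvPolynomial in
/-- The special system. -/
def spPoly {s : ℕ} (N : ℕ) (d : Fin s → ℕ) (i : Fin s) : MvPolynomial (Fin (N + 2)) ℂ :=
  open Classical in
  ∑ k : Fin N, if blkOff d i ≤ 2 * k + 1 ∧ 2 * k ≤ blkOff d i + d i then
    X k.succ.succ * ∏ r ∈ ((Finset.range (d i + 1)).erase
      (min (2 * k - blkOff d i) (d i - 1))).erase (min (2 * k - blkOff d i) (d i - 1) + 1),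
      (X 1 - C (r : ℂ) * X 0) else 0

open MvPolynomial in
lemma spPoly_homog {s : ℕ} (N : ℕ) (d : Fin s → ℕ) (hd : ∀ i, 2 ≤ d i) (i : Fin s) :
    (spPoly N d i).IsHomogeneous (d i) := by
  classical
  refine IsHomogeneous.sum _ _ _ fun k _ => ?_
  have hdi := hd i
  split_ifs with h
  swap
  · exact isHomogeneous_zero _ _ _
  have h1 := (isHomogeneous_X ℂ (k.succ.succ : Fin (N + 2))).mul
    (IsHomogeneous.prod (((Finset.range (d i + 1)).erase
      (min (2 * k - blkOff d i) (d i - 1))).erase (min (2 * k - blkOff d i) (d i - 1) + 1))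
      (fun r : ℕ => (X 1 - C (r : ℂ) * X 0 : MvPolynomial (Fin (N + 2)) ℂ)) (fun _ => 1)
      (fun r _ => (isHomogeneous_X ℂ 1).sub (by simpa using (isHomogeneous_C _ (r:ℂ)).mul (isHomogeneous_X ℂ 0))))
  convert h1 using 1
  rw [Finset.sum_const, Finset.card_erase_of_mem, Finset.card_erase_of_mem, Finset.card_range]
  · simp; omega
  · simp
  · simp
    omega

lemma exists_special {s : ℕ} (N : ℕ) (d : Fin s → ℕ) (hd : ∀ i, 2 ≤ d i)
    (hN : ∑ i, d i + s ≤ 2 * N) :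
    ∃ f0 : Fin s → MvPolynomial (Fin (N + 2)) ℂ, (∀ i, (f0 i).IsHomogeneous (d i)) ∧
    ∃ Λ : (Fin 2 → Fin N → ℂ) →ₗ[ℂ] ((Σ i, Fin (d i + 1)) → ℂ), Function.Surjective Λ ∧
      ∀ a p, MvPolynomial.eval (stdPt a (p.2 : ℕ)) (f0 p.1) = Λ a p := by
  classical
  let Q : Fin s → ℕ → ℕ → ℂ := fun i k j =>
    if blkOff d i ≤ 2 * k + 1 ∧ 2 * k ≤ blkOff d i + d i then
     ∏ r ∈ ((Finset.range (d i + 1)).erase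
      (min (2 * k - blkOff d i) (d i - 1))).erase (min (2 * k - blkOff d i) (d i - 1) + 1),
      ((j:ℂ) - r) else 0
  have hQ : ∀ i k j, j ≤ d i → (Q i k j ≠ 0 ↔ spCond d i k j) := by
    intro i k j hj
    simp only [Q, spCond]
    split_ifs with h
    · simp only [h, true_and, Finset.prod_ne_zero_iff, Finset.mem_erase, Finset.mem_range,
        sub_ne_zero, ne_eq, Nat.cast_inj]
      constructor
      · intro h2
        by_contra! hc
        exact h2 j ⟨hc.2, hc.1, by omega⟩ rfl
      · rintro h2 r hr rfl
        omega
    · simp only [ne_eq, not_true_eq_false, false_iff]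
      tauto
  let Λ : (Fin 2 → Fin N → ℂ) →ₗ[ℂ] ((Σ i, Fin (d i + 1)) → ℂ) :=
    { toFun := fun a p => ∑ k : Fin N, (a 0 k + (p.2 : ℕ) * a 1 k) * Q p.1 k p.2
      map_add' := by
        intro a b; ext p
        simp only [Pi.add_apply, ← Finset.sum_add_distrib]
        exact Finset.sum_congr rfl fun k _ => by ring
      map_smul' := by
        intro c a; ext p
        simp only [Pi.smul_apply, smul_eq_mul, Finset.mul_sum, RingHom.id_apply]
        exact Finset.sum_congr rfl fun k _ => by ring }
  refine ⟨spPoly N d, spPoly_homog N d hd, Λ, ?_, ?_⟩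
  · rw [← LinearMap.range_eq_top]
    refine range_top_of_cond d hd hN Q hQ _ ?_
    intro k hk α β
    refine ⟨fun z => Pi.single ⟨k, hk⟩ (if z = 0 then α else β), ?_⟩
    ext p
    simp only [Λ, LinearMap.coe_mk, AddHom.coe_mk]
    rw [Finset.sum_eq_single ⟨k, hk⟩]
    · simp [mul_comm]
    · intro b _ hb
      simp [Pi.single_eq_of_ne hb]
    · simp
  · intro a p
    simp only [spPoly, map_sum, Λ, LinearMap.coe_mk, AddHom.coe_mk, Q]
    refine Finset.sum_congr rfl fun k _ => ?_
    split_ifs with h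
    · simp only [map_mul, map_prod, map_sub, MvPolynomial.eval_X, MvPolynomial.eval_C]
      have h0 : stdPt a (p.2 : ℕ) 0 = 1 := rfl
      have h1 : stdPt a (p.2 : ℕ) 1 = (p.2 : ℕ) := rfl
      have h2 : stdPt a (p.2 : ℕ) k.succ.succ = a 0 k + (p.2 : ℕ) * a 1 k := rfl
      rw [h0, h1, h2]
      simp
    · simp
end PartC

section PartD
open Topology in
lemma small_solutions {E F : Type} [NormedAddCommGroup E] [NormedSpace ℂ E] [CompleteSpace E]
    [NormedAddCommGroup F] [NormedSpace ℂ F] [CompleteSpace F]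
    (Λ : E →L[ℂ] F) (hΛ : Function.Surjective Λ) (G : E → F)
    (G' : E →L[ℂ] F) (hG : HasStrictFDerivAt G G' 0) :
    {t : ℂ | ∃ a, (1 - t) • Λ a + t • G a = 0}.Infinite := by
  let Ψ : E × ℂ → F × ℂ := fun x => ((1 - x.2) • Λ x.1 + x.2 • G x.1, x.2)
  let D : E × ℂ →L[ℂ] F × ℂ :=
    (Λ.comp (ContinuousLinearMap.fst ℂ E ℂ) + (ContinuousLinearMap.snd ℂ E ℂ).smulRight (G 0)).prod
      (ContinuousLinearMap.snd ℂ E ℂ)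
  have h1 : HasStrictFDerivAt (fun x : E × ℂ => Λ x.1) (Λ.comp (ContinuousLinearMap.fst ℂ E ℂ)) (0, 0) :=
    Λ.hasStrictFDerivAt.comp (0, 0) hasStrictFDerivAt_fst
  have h2 : HasStrictFDerivAt (fun x : E × ℂ => x.2) (ContinuousLinearMap.snd ℂ E ℂ) (0, 0) :=
    hasStrictFDerivAt_snd
  have h3 : HasStrictFDerivAt (fun x : E × ℂ => G x.1) (G'.comp (ContinuousLinearMap.fst ℂ E ℂ)) (0, 0) :=
    HasStrictFDerivAt.comp (0, 0) hG hasStrictFDerivAt_fst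
  have hD : HasStrictFDerivAt Ψ D (0, 0) := by
    have h4 := (((h2.const_sub 1).smul h1).add (h2.smul h3)).prodMk h2
    refine h4.congr_fderiv ?_
    ext x <;> simp [D]
  have hsurj : D.range = ⊤ := by
    rw [LinearMap.range_eq_top]
    rintro ⟨y, τ⟩
    obtain ⟨b, hb⟩ := hΛ (y - τ • G 0)
    exact ⟨(b, τ), by simp [D, hb]⟩
  have hmap := hD.map_nhds_eq_of_surj hsurj
  have hΨ0 : Ψ (0, 0) = (0, 0) := by simp [Ψ]
  rw [hΨ0] at hmap
  have hr : Set.range Ψ ∈ 𝓝 ((0, 0) : F × ℂ) := by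
    rw [← hmap]; exact Filter.range_mem_map
  have hc : Filter.Tendsto (fun t : ℂ => ((0, t) : F × ℂ)) (𝓝 0) (𝓝 (0, 0)) :=
    (Continuous.prodMk_right (0 : F)).tendsto 0
  have := hc hr
  refine infinite_of_mem_nhds 0 (Filter.mem_of_superset this ?_)
  rintro t ⟨⟨a, τ⟩, ha⟩
  simp only [Ψ, Prod.mk.injEq] at ha
  obtain ⟨h5, rfl⟩ := ha
  exact ⟨a, h5⟩

open MvPolynomial in
lemma mvPoly_contDiff {σ : Type} [Fintype σ] (E : Type) [NormedAddCommGroup E] [NormedSpace ℂ E]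
   (v : E → σ → ℂ) (hv : ContDiff ℂ 1 v) (f : MvPolynomial σ ℂ) : ContDiff ℂ 1 (fun a => eval (v a) f) := by
  induction f using MvPolynomial.induction_on with
  | C c => simpa using contDiff_const
  | add p q hp hq => simpa using hp.add hq
  | mul_X p i hp => simpa using hp.mul ((contDiff_pi.mp hv) i)
end PartD

section PartE
open MvPolynomial in
lemma eval_smul_homog {σ : Type} {g : MvPolynomial σ ℂ} {d : ℕ} (hg : g.IsHomogeneous d)
    (c : ℂ) (x : σ → ℂ) : eval (c • x) g = c ^ d * eval x g := by
  rw [eval_eq, eval_eq, Finset.mul_sum]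
  refine Finset.sum_congr rfl fun m hm => ?_
  have h := hg (mem_support_iff.mp hm)
  rw [Finsupp.weight_apply] at h
  simp only [Pi.smul_apply, smul_eq_mul, mul_pow, Finset.prod_mul_distrib]
  rw [Finset.prod_pow_eq_pow_sum]
  have : ∑ i ∈ m.support, m i = d := by simpa [Finsupp.sum] using h
  rw [this]; ring
open MvPolynomial in
lemma line_vanish {σ : Type} {g : MvPolynomial σ ℂ} {d : ℕ} (hg : g.IsHomogeneous d)
    (u v : σ → ℂ) (h : ∀ j : ℕ, j ≤ d → eval (u + (j : ℂ) • v) g = 0) (α β : ℂ) :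
    eval (α • u + β • v) g = 0 := by
  have ev : ∀ (p q : σ → ℂ) (t : ℂ), Polynomial.eval t
      (aeval (fun i => Polynomial.C (p i) + Polynomial.X * Polynomial.C (q i)) g)
      = eval (p + t • q) g := by
    intro p q t
    have : (Polynomial.aeval t).comp (aeval (R := ℂ) (fun i => Polynomial.C (p i) +
        Polynomial.X * Polynomial.C (q i))) = aeval (p + t • q) := by
      ext i
      simp
      ring
    exact DFunLike.congr_fun this g
  have h0 : ∀ t : ℂ, eval (u + t • v) g = 0 := by
    intro t
    rw [← ev]
    have : (aeval (fun i => Polynomial.C (u i) + Polynomial.X * Polynomial.C (v i)) g) = 0 := by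
      apply Polynomial.eq_zero_of_natDegree_lt_card_of_eval_eq_zero _
        (f := fun j : Fin (d + 1) => ((j : ℕ) : ℂ))
      · intro i j hij
        simpa [Fin.ext_iff] using hij
      · intro j
        rw [ev]; exact h _ (by omega)
      · have := MvPolynomial.aeval_natDegree_le g (hg.totalDegree_le)
          (fun i => Polynomial.C (u i) + Polynomial.X * Polynomial.C (v i)) (n := 1) (by
            intro i; compute_degree)
        simp at this ⊢
        omega
    rw [this]; simp
  have h1 : ∀ α β : ℂ, α ≠ 0 → eval (α • u + β • v) g = 0 := by
    intro α β hα
    have : α • u + β • v = α • (u + (β / α) • v) := by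
      rw [smul_add, smul_smul, mul_div_cancel₀ _ hα]
    rw [this, eval_smul_homog hg, h0, mul_zero]
  have h2 : (aeval (fun i => Polynomial.C ((β • v) i) + Polynomial.X * Polynomial.C (u i)) g) = 0 := by
    apply Polynomial.eq_zero_of_infinite_isRoot
    refine Set.Infinite.mono (s := {0}ᶜ) ?_ (Set.finite_singleton _).infinite_compl
    intro t ht
    simp only [Set.mem_ofPred_eq, Polynomial.IsRoot.def]
    rw [ev, add_comm]
    exact h1 _ _ ht
  rw [add_comm, ← ev, h2]; simp
end PartE

open MvPolynomial in
/-- Substitution of the image of a vector under a generic matrix. -/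
def matSub {M : ℕ} (c : Fin M → ℂ) : MvPolynomial (Fin M) ℂ →ₐ[ℂ] MvPolynomial (Fin M × Fin M) ℂ :=
  aeval fun r => ∑ j, C (c j) * X (r, j)

open MvPolynomial in
lemma matSub_eval {M : ℕ} (c : Fin M → ℂ) (x : Fin M × Fin M → ℂ) (g : MvPolynomial (Fin M) ℂ) :
    eval x (matSub c g) = eval (fun r => ∑ j, c j * x (r, j)) g := by
  have : (aeval (R := ℂ) x).comp (matSub c) = aeval (fun r => ∑ j, c j * x (r, j)) := by
    ext i; simp [matSub]
  exact DFunLike.congr_fun this g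

open MvPolynomial in
lemma matSub_homog {M : ℕ} (c : Fin M → ℂ) (g : MvPolynomial (Fin M) ℂ) (d : ℕ)
    (hg : g.IsHomogeneous d) : (matSub c g).IsHomogeneous d := by
  have := hg.aeval (fun r => ∑ j, C (c j) * X (r, j) : Fin M → MvPolynomial (Fin M × Fin M) ℂ)
    (n := 1) (by
      intro r
      refine IsHomogeneous.sum _ _ _ fun j _ => ?_
      simpa using (isHomogeneous_C _ (c j)).mul (isHomogeneous_X ℂ (r, j)))
  rw [one_mul] at this
  exact this

open MvPolynomial in
lemma exists_line {s : ℕ} (N : ℕ) (d : Fin s → ℕ) (hd : ∀ i, 2 ≤ d i)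
    (hN : ∑ i, d i + s ≤ 2 * N) (f : Fin s → MvPolynomial (Fin (N + 2)) ℂ)
    (hf : ∀ i, (f i).IsHomogeneous (d i)) :
    ∃ W : Submodule ℂ (Fin (N + 2) → ℂ), Module.finrank ℂ W = 2 ∧
      ∀ w ∈ W, ∀ i, eval w (f i) = 0 := by
  by_contra hcon
  obtain ⟨f0, hf0, Λ, hΛ, hΛe⟩ := exists_special N d hd hN
  let sysm (g : Fin s → MvPolynomial (Fin (N + 2)) ℂ) :
      (Fin (N + 2) × Fin (N + 2)) ⊕ (Fin s × (Fin (N + 2) → ℂ)) →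
        MvPolynomial (Fin (N + 2) × Fin (N + 2)) ℂ :=
    Sum.elim (fun p => X (p.1, p.2) + X (p.2, p.1)) (fun q => matSub q.2 (g q.1))
  let e : (Fin (N + 2) × Fin (N + 2)) ⊕ (Fin s × (Fin (N + 2) → ℂ)) → ℕ :=
    Sum.elim (fun _ => 1) (fun q => d q.1)
  have hsys : ∀ g : Fin s → MvPolynomial (Fin (N + 2)) ℂ, (∀ i, (g i).IsHomogeneous (d i)) →
      ∀ k, (sysm g k).IsHomogeneous (e k) := by
    rintro g hg (p | q)
    · exact (isHomogeneous_X ℂ _).add (isHomogeneous_X ℂ _)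
    · exact matSub_homog _ _ _ (hg _)
  have hfin := elimination (sysm f0) (sysm f) e (hsys _ hf0) (hsys _ hf) (by
    intro x hx
    by_contra hx0
    apply hcon
    have hanti : ∀ i j, x (i, j) = - x (j, i) := by
      intro i j
      have := hx (Sum.inl (i, j))
      simp only [sysm, Sum.elim_inl, map_add, eval_X] at this
      exact eq_neg_of_add_eq_zero_left this
    have hv : ∀ i (c : Fin (N + 2) → ℂ), eval (fun r => ∑ j, c j * x (r, j)) (f i) = 0 := by
      intro i c
      have := hx (Sum.inr (i, c))
      simp only [sysm, Sum.elim_inr] at this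
      rwa [matSub_eval] at this
    obtain ⟨⟨i, j⟩, hij⟩ : ∃ p, x p ≠ 0 := by
      by_contra h; push Not at h; exact hx0 (funext h)
    have hii : ∀ i, x (i, i) = 0 := fun i => by
      have := hanti i i
      exact self_eq_neg.mp this
    let U : Fin 2 → Fin (N + 2) → ℂ := ![fun r => x (r, i), fun r => x (r, j)]
    have hli : LinearIndependent ℂ U := by
      rw [LinearIndependent.pair_iff]
      intro a b hab
      have h1 := congrFun hab i
      have h2 := congrFun hab j
      simp [hii, hij] at h1
      simp [hii, hanti j i, hij] at h2
      exact ⟨h2, h1⟩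
    refine ⟨Submodule.span ℂ (Set.range U), ?_, ?_⟩
    · rw [finrank_span_eq_card hli]; simp
    · intro w hw k
      rw [Submodule.mem_span_range_iff_exists_fun] at hw
      obtain ⟨c, rfl⟩ := hw
      have := hv k (c 0 • Pi.single i 1 + c 1 • Pi.single j 1)
      convert this using 3 with r
      simp [U, add_mul, Finset.sum_add_distrib, Pi.single_apply]
      rfl)
  let G : (Fin 2 → Fin N → ℂ) → ((Σ i, Fin (d i + 1)) → ℂ) :=
    fun a p => eval (stdPt a (p.2 : ℕ)) (f p.1)
  have hG : ContDiff ℂ 1 G := by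
    rw [contDiff_pi]
    intro p
    apply mvPoly_contDiff
    rw [contDiff_pi]
    intro r
    refine Fin.cases ?_ (fun r => Fin.cases ?_ (fun r => ?_) r) r
    · simpa [stdPt] using contDiff_const
    · simpa [stdPt] using contDiff_const
    · simp only [stdPt, Fin.cons_succ]
      fun_prop
  have hinf := small_solutions (LinearMap.toContinuousLinearMap Λ) hΛ G _
    (hG.contDiffAt.hasStrictFDerivAt (by simp))
  apply hinf
  refine hfin.subset ?_
  rintro t ⟨a, ha⟩
  let u : Fin (N + 2) → ℂ := Fin.cons 1 (Fin.cons 0 (a 0))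
  let v : Fin (N + 2) → ℂ := Fin.cons 0 (Fin.cons 1 (a 1))
  have huv : ∀ z : ℂ, u + z • v = stdPt a z := by
    intro z
    funext r
    refine Fin.cases ?_ (fun r => Fin.cases ?_ (fun r => ?_) r) r <;> simp [u, v, stdPt]
  have hline : ∀ i (α β : ℂ), eval (α • u + β • v) (C (1 - t) * f0 i + C t * f i) = 0 := by
    intro i
    apply line_vanish (d := d i)
    · have h1 := (isHomogeneous_C (Fin (N+2)) (1 - t)).mul (hf0 i)
      have h2 := (isHomogeneous_C (Fin (N+2)) t).mul (hf i)
      simpa using h1.add h2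
    · intro j hj
      have := congrFun ha ⟨i, ⟨j, by omega⟩⟩
      rw [huv]
      simp [G, ← hΛe] at this
      simpa using this
  refine ⟨fun p => u p.1 * v p.2 - u p.2 * v p.1, ?_, ?_⟩
  · intro h
    have := congrFun h (0, 1)
    simp [u, v] at this
  · rintro (p | q)
    · simp [sysm]
    · have := hline q.1 (∑ j, q.2 j * v j) (- ∑ j, q.2 j * u j)
      simp only [sysm, Sum.elim_inr, matSub_eval]
      simp only [map_add, map_mul, eval_C] at this
      convert this using 6 <;>
      · simp [Finset.sum_mul, ← Finset.sum_sub_distrib, mul_sub, ← sub_eq_add_neg]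
        exact Finset.sum_congr rfl fun _ _ => by ring

open MvPolynomial in
lemma chart_irred {σ Y T : Type} [Finite σ] [TopologicalSpace Y] [TopologicalSpace T]
    (ψ : (σ → ℂ) → Y)
    (hψ : ∀ V : Set Y, IsOpen V → ∀ a, ψ a ∈ V → ∃ h : MvPolynomial σ ℂ, eval a h ≠ 0 ∧
      ∀ b, eval b h ≠ 0 → ψ b ∈ V)
    (i : T → Y) (hi : Topology.IsInducing i) (q : Ideal (MvPolynomial σ ℂ)) [hq : q.IsPrime]
    (hr : ∀ a, (∀ g ∈ q, eval a g = 0) → ∃ c, i c = ψ a) :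
    IsIrreducible {c : T | ∃ a, (∀ g ∈ q, eval a g = 0) ∧ i c = ψ a} := by
  constructor
  · obtain ⟨a, ha, -⟩ := exists_point_of_notMem q (h := 1)
      ((Ideal.ne_top_iff_one q).mp hq.ne_top)
    obtain ⟨c, hc⟩ := hr a ha
    exact ⟨c, a, ha, hc⟩
  · rintro u v hu hv ⟨c, ⟨a, ha, hca⟩, hcu⟩ ⟨c', ⟨a', ha', hca'⟩, hcv⟩
    obtain ⟨u', hu', rfl⟩ := hi.isOpen_iff.mp hu
    obtain ⟨v', hv', rfl⟩ := hi.isOpen_iff.mp hv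
    obtain ⟨h, hh, H⟩ := hψ u' hu' a (hca ▸ hcu)
    obtain ⟨h', hh', H'⟩ := hψ v' hv' a' (hca' ▸ hcv)
    have hn : h * h' ∉ q := by
      intro hm
      rcases hq.mem_or_mem hm with hm | hm
      · exact hh (ha _ hm)
      · exact hh' (ha' _ hm)
    obtain ⟨b, hb, hne⟩ := exists_point_of_notMem q hn
    rw [map_mul] at hne
    obtain ⟨c'', hc''⟩ := hr b hb
    refine ⟨c'', ⟨b, hb, hc''⟩, ?_, ?_⟩
    · change i c'' ∈ u'
      rw [hc'']; exact H b (left_ne_zero_of_mul hne)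
    · change i c'' ∈ v'
      rw [hc'']; exact H' b (right_ne_zero_of_mul hne)

open MvPolynomial in
lemma chart_dim {σ Y : Type} [Finite σ] [TopologicalSpace Y]
    (ψ : (σ → ℂ) → Y) (hU : IsOpen (Set.range ψ))
    (hψ : ∀ V : Set Y, IsOpen V → ∀ a, ψ a ∈ V → ∃ h : MvPolynomial σ ℂ, eval a h ≠ 0 ∧
      ∀ b, eval b h ≠ 0 → ψ b ∈ V)
    (hcl : ∀ h : MvPolynomial σ ℂ, ∃ Z : Set Y, IsClosed Z ∧ ∀ a, ψ a ∈ Z ↔ eval a h = 0)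
    (F : Set Y) (S : Set (MvPolynomial σ ℂ)) (D : ℕ) (hS : S.encard ≤ D)
    (hF : ∀ a, ψ a ∈ F ↔ ∀ g ∈ S, eval a g = 0)
    (C : Set F) (hC : C ∈ irreducibleComponents F) (a0 : σ → ℂ) (c0 : F) (hc0 : c0 ∈ C)
    (hca : c0.1 = ψ a0) :
    ((Nat.card σ - D : ℕ) : WithBot ℕ∞) ≤ topologicalKrullDim ↥C := by
  have hCirr : IsIrreducible C := hC.1
  have hCmax : ∀ T : Set F, IsIrreducible T → C ⊆ T → T ⊆ C := fun T hT h => hC.2 hT h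
  let K : Set (σ → ℂ) := {a | ∃ c ∈ C, c.1 = ψ a}
  let p : Ideal (MvPolynomial σ ℂ) := vanishingIdeal ℂ K
  have hmem : ∀ h, h ∈ p ↔ ∀ a ∈ K, eval a h = 0 := fun h => by
    simp only [p, mem_vanishingIdeal_iff, aeval_eq_eval]
  have hpp : p.IsPrime := by
    refine ⟨?_, ?_⟩
    · rw [Ideal.ne_top_iff_one, hmem]
      intro h
      simpa using h a0 ⟨c0, hc0, hca⟩
    · intro h1 h2 h12
      by_contra hcon
      push Not at hcon
      obtain ⟨hn1, hn2⟩ := hcon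
      rw [hmem] at hn1 hn2
      push Not at hn1 hn2
      obtain ⟨a1, ⟨c1, hc1, e1⟩, hz1⟩ := hn1
      obtain ⟨a2, ⟨c2, hc2, e2⟩, hz2⟩ := hn2
      obtain ⟨Z1, hZ1, HZ1⟩ := hcl h1
      obtain ⟨Z2, hZ2, HZ2⟩ := hcl h2
      obtain ⟨c, hc, hcu, hcv⟩ := hCirr.2 (Subtype.val ⁻¹' (Set.range ψ ∩ Z1ᶜ))
        (Subtype.val ⁻¹' (Set.range ψ ∩ Z2ᶜ))
        ((hU.inter hZ1.isOpen_compl).preimage continuous_subtype_val)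
        ((hU.inter hZ2.isOpen_compl).preimage continuous_subtype_val)
        ⟨c1, hc1, ⟨a1, e1.symm⟩, by rw [e1]; exact fun h => hz1 ((HZ1 _).mp h)⟩
        ⟨c2, hc2, ⟨a2, e2.symm⟩, by rw [e2]; exact fun h => hz2 ((HZ2 _).mp h)⟩
      obtain ⟨⟨a, ha⟩, hca1⟩ := hcu
      obtain ⟨-, hca2⟩ := hcv
      have h3 := (hmem _).mp h12 a ⟨c, hc, ha.symm⟩
      rw [← ha] at hca1 hca2
      rw [map_mul] at h3
      rcases mul_eq_zero.mp h3 with h | h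
      · exact hca1 ((HZ1 _).mpr h)
      · exact hca2 ((HZ2 _).mpr h)
  have claim : ∀ q : Ideal (MvPolynomial σ ℂ), q.IsPrime → S ⊆ q → q ≤ p →
      ∀ a, (∀ g ∈ q, eval a g = 0) → a ∈ K := by
    intro q hq hSq hqp a ha
    have hr : ∀ a, (∀ g ∈ q, eval a g = 0) → ∃ c : F, c.1 = ψ a := fun a ha =>
      ⟨⟨ψ a, (hF a).mpr fun g hg => ha g (hSq hg)⟩, rfl⟩
    have hirr := (chart_irred ψ hψ (Subtype.val : F → Y) Topology.IsInducing.subtypeVal q hr).closure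
    have hsub := hCmax _ hirr (by
      intro x hx
      rw [mem_closure_iff]
      intro V hV hxV
      obtain ⟨c, hc, hcV, b, hb⟩ := hCirr.2 V (Subtype.val ⁻¹' (Set.range ψ)) hV
        (hU.preimage continuous_subtype_val) ⟨x, hx, hxV⟩ ⟨c0, hc0, a0, hca.symm⟩
      exact ⟨c, hcV, b, fun g hg => (hmem g).mp (hqp hg) b ⟨c, hc, hb.symm⟩, hb.symm⟩)
    obtain ⟨c, hc⟩ := hr a ha
    exact ⟨c, hsub (subset_closure ⟨a, ha, hc⟩), hc⟩
  have hSp : S ⊆ p := by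
    intro g hg
    change g ∈ p
    rw [hmem]
    rintro a ⟨c, hc, e⟩
    exact (hF a).mp (e ▸ c.2) g hg
  have hmin : p ∈ (Ideal.span S).minimalPrimes := by
    refine ⟨⟨hpp, Ideal.span_le.mpr hSp⟩, ?_⟩
    rintro q ⟨hq, hSq⟩ hqp h hh
    by_contra hn
    obtain ⟨a, ha, hne⟩ := exists_point_of_notMem q hn
    exact hne ((hmem h).mp hh a (claim q hq (Ideal.span_le.mp hSq) hqp a ha))
  obtain ⟨l, hl, hlen⟩ := exists_chain S D hS p hmin
  have hi : Topology.IsInducing (fun c : C => c.1.1) :=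
    Topology.IsInducing.subtypeVal.comp Topology.IsInducing.subtypeVal
  have hge : ∀ j, p ≤ (l j).asIdeal := fun j => hl.trans (l.head_le j)
  have hr : ∀ j, ∀ a, (∀ g ∈ (l j).asIdeal, eval a g = 0) → ∃ c : C, c.1.1 = ψ a := by
    intro j a ha
    obtain ⟨c, hc, e⟩ := claim p hpp hSp le_rfl a fun g hg => ha g (hge j hg)
    exact ⟨⟨c, hc⟩, e⟩
  let A : Fin (l.length + 1) → Set C :=
    fun j => {c : C | ∃ a, (∀ g ∈ (l j).asIdeal, eval a g = 0) ∧ c.1.1 = ψ a}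
  have hA : ∀ j, IsIrreducible (A j) := fun j => by
    have := (l j).isPrime
    exact chart_irred ψ hψ (fun c : C => c.1.1) hi (l j).asIdeal (hr j)
  have hlt : ∀ j k, j < k → closure (A k) < closure (A j) := by
    intro j k hjk
    have hjk' : (l j).asIdeal < (l k).asIdeal := l.strictMono hjk
    refine Set.ssubset_iff_exists.mpr ⟨closure_mono ?_, ?_⟩
    · rintro c ⟨a, ha, e⟩
      exact ⟨a, fun g hg => ha g (hjk'.le hg), e⟩
    · obtain ⟨h, hk, hj⟩ := Set.exists_of_ssubset hjk'
      have := (l j).isPrime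
      obtain ⟨a, ha, hne⟩ := exists_point_of_notMem (l j).asIdeal hj
      obtain ⟨Z, hZ, HZ⟩ := hcl h
      obtain ⟨c, hc⟩ := hr j a ha
      refine ⟨c, subset_closure ⟨a, ha, hc⟩, fun hcl => ?_⟩
      have hsub : closure (A k) ⊆ (fun c : C => c.1.1) ⁻¹' Z := by
        refine closure_minimal ?_ (hZ.preimage hi.continuous)
        rintro c ⟨b, hb, e⟩
        change c.1.1 ∈ Z
        rw [e, HZ]
        exact hb h hk
      have h5 : c.1.1 ∈ Z := hsub hcl
      rw [hc, HZ] at h5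
      exact hne h5
  let L : LTSeries (TopologicalSpace.IrreducibleCloseds C) :=
    LTSeries.mk l.length (fun j => ⟨closure (A j.rev), (hA _).closure, isClosed_closure⟩) (by
      intro j k hjk
      exact hlt _ _ (Fin.rev_lt_rev.mpr hjk))
  have h6 : ((L.length : ℕ) : WithBot ℕ∞) ≤ topologicalKrullDim ↥C := Order.LTSeries.length_le_krullDim L
  refine le_trans ?_ h6
  have : Nat.card σ - D ≤ L.length := by change _ ≤ l.length; omega
  exact_mod_cast this

open MvPolynomial in
lemma mem_fano_iff {n s : ℕ} {d : Fin s → ℕ} {f : Fin s → MvPolynomial (Fin (n + 1)) ℂ}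
    {X : Set (Projectivization ℂ (Fin (n + 1) → ℂ))} (hX : IsSmoothCI n s d f X)
    (W : ProjLine n) : W ∈ fanoLines X ↔ ∀ w ∈ W.1, ∀ i, eval w (f i) = 0 := by
  change lineSet W.1 ⊆ X ↔ _
  rw [hX.locus]
  constructor
  · intro h w hw i
    by_cases hw0 : w = 0
    · have := eval_smul_homog (hX.homog i) 0 w
      rw [zero_smul, zero_pow (by have := hX.two_le_deg i; omega), zero_mul] at this
      rw [hw0, this]
    · obtain ⟨c, hc⟩ := Projectivization.exists_smul_eq_mk_rep ℂ w hw0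
      have h1 : (Projectivization.mk ℂ w hw0).rep ∈ W.1 := by
        rw [← hc]; exact W.1.smul_mem _ hw
      have h2 : eval (Projectivization.mk ℂ w hw0).rep (f i) = 0 := h h1 i
      rw [← hc, Units.smul_def, eval_smul_homog (hX.homog i)] at h2
      exact (mul_eq_zero.mp h2).resolve_left (pow_ne_zero _ c.ne_zero)
  · intro h x hx i
    exact h _ hx i

section Chart
variable {N : ℕ} (Bs : Module.Basis (Fin 2 ⊕ Fin N) ℂ (Fin (N + 2) → ℂ))

/-- The two vectors spanning the line with affine coordinates `a`. -/
def chPt (a : Fin 2 × Fin N → ℂ) (e : Fin 2) : Fin (N + 2) → ℂ :=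
  Bs (Sum.inl e) + ∑ k, a (e, k) • Bs (Sum.inr k)

lemma chPt_repr_inl (a : Fin 2 × Fin N → ℂ) (e e' : Fin 2) :
    Bs.repr (chPt Bs a e) (Sum.inl e') = if e = e' then 1 else 0 := by
  simp [chPt, Finsupp.single_apply]

lemma chPt_repr_inr (a : Fin 2 × Fin N → ℂ) (e : Fin 2) (k : Fin N) :
    Bs.repr (chPt Bs a e) (Sum.inr k) = a (e, k) := by
  simp [chPt, Finsupp.single_apply]

lemma chPt_indep (a : Fin 2 × Fin N → ℂ) : LinearIndependent ℂ (chPt Bs a) := by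
  rw [Fintype.linearIndependent_iff]
  intro g hg e
  have := congrArg (fun w => Bs.repr w (Sum.inl e)) hg
  fin_cases e <;> simpa [chPt_repr_inl] using this

/-- The chart of the Grassmannian. -/
def chart (a : Fin 2 × Fin N → ℂ) : ProjLine (N + 1) :=
  ⟨Submodule.span ℂ (Set.range (chPt Bs a)), by
    rw [finrank_span_eq_card (chPt_indep Bs a)]; simp⟩

lemma mem_chart (a : Fin 2 × Fin N → ℂ) (w : Fin (N + 2) → ℂ) :
    w ∈ (chart Bs a).1 ↔ ∃ c : Fin 2 → ℂ, w = ∑ e, c e • chPt Bs a e := by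
  change w ∈ Submodule.span ℂ (Set.range (chPt Bs a)) ↔ _
  rw [Submodule.mem_span_range_iff_exists_fun]
  simp only [eq_comm]

lemma chart_repr {a : Fin 2 × Fin N → ℂ} {w : Fin (N + 2) → ℂ} (hw : w ∈ (chart Bs a).1)
    (k : Fin N) : Bs.repr w (Sum.inr k) =
      Bs.repr w (Sum.inl 0) * a (0, k) + Bs.repr w (Sum.inl 1) * a (1, k) := by
  obtain ⟨c, rfl⟩ := (mem_chart Bs a w).mp hw
  simp [chPt_repr_inl, chPt_repr_inr]

open MvPolynomial in
/-- Coordinate forms with respect to the basis. -/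
def coordP {τ : Type} (ι : Fin (N + 2) → τ) (j : Fin 2 ⊕ Fin N) : MvPolynomial τ ℂ :=
  ∑ r, C (Bs.repr (Pi.single r 1) j) * X (ι r)

open MvPolynomial in
lemma coordP_eval {τ : Type} (ι : Fin (N + 2) → τ) (j : Fin 2 ⊕ Fin N) (x : τ → ℂ) :
    eval x (coordP Bs ι j) = Bs.repr (fun r => x (ι r)) j := by
  have h := LinearMap.pi_apply_eq_sum_univ (Bs.coord j) (fun r => x (ι r))
  simp only [Module.Basis.coord_apply] at h
  rw [h]
  simp only [coordP, map_sum, map_mul, eval_C, eval_X, smul_eq_mul]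
  refine Finset.sum_congr rfl fun r _ => ?_
  rw [mul_comm]
  congr 4
  funext t
  simp [Pi.single_apply, eq_comm]

/-- The Pluecker coordinate defining the chart. -/
def detP : MvPolynomial (Fin (N + 2) ⊕ Fin (N + 2)) ℂ :=
  coordP Bs Sum.inl (Sum.inl 0) * coordP Bs Sum.inr (Sum.inl 1) -
    coordP Bs Sum.inl (Sum.inl 1) * coordP Bs Sum.inr (Sum.inl 0)

open MvPolynomial in
lemma detP_eval (u v : Fin (N + 2) → ℂ) : eval (Sum.elim u v) (detP Bs) =
    Bs.repr u (Sum.inl 0) * Bs.repr v (Sum.inl 1) -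
      Bs.repr u (Sum.inl 1) * Bs.repr v (Sum.inl 0) := by
  simp [detP, coordP_eval]

open MvPolynomial in
lemma chart_poly (h : MvPolynomial (Fin 2 × Fin N) ℂ) :
    ∃ (F : MvPolynomial (Fin (N + 2) ⊕ Fin (N + 2)) ℂ) (m : ℕ), ∀ a, ∀ u ∈ (chart Bs a).1,
      ∀ v ∈ (chart Bs a).1, eval (Sum.elim u v) F =
        eval (Sum.elim u v) (detP Bs) ^ m * eval a h := by
  induction h using MvPolynomial.induction_on with
  | C c => exact ⟨C c, 0, by simp⟩
  | add p q hp hq =>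
    obtain ⟨F1, m1, h1⟩ := hp
    obtain ⟨F2, m2, h2⟩ := hq
    refine ⟨F1 * detP Bs ^ m2 + F2 * detP Bs ^ m1, m1 + m2, fun a u hu v hv => ?_⟩
    simp only [map_add, map_mul, map_pow, h1 a u hu v hv, h2 a u hu v hv]
    ring
  | mul_X p i hp =>
    obtain ⟨F1, m1, h1⟩ := hp
    obtain ⟨e, k⟩ := i
    let G : Fin 2 → MvPolynomial (Fin (N + 2) ⊕ Fin (N + 2)) ℂ :=
      ![coordP Bs Sum.inl (Sum.inr k) * coordP Bs Sum.inr (Sum.inl 1) -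
          coordP Bs Sum.inl (Sum.inl 1) * coordP Bs Sum.inr (Sum.inr k),
        coordP Bs Sum.inl (Sum.inl 0) * coordP Bs Sum.inr (Sum.inr k) -
          coordP Bs Sum.inl (Sum.inr k) * coordP Bs Sum.inr (Sum.inl 0)]
    refine ⟨F1 * G e, m1 + 1, fun a u hu v hv => ?_⟩
    have hG : eval (Sum.elim u v) (G e) = eval (Sum.elim u v) (detP Bs) * a (e, k) := by
      have h1 := chart_repr Bs hu k
      have h2 := chart_repr Bs hv k
      rw [detP_eval]
      fin_cases e
      · simp [G, coordP_eval, h1, h2]; ring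
      · simp [G, coordP_eval, h1, h2]; ring
    simp only [map_mul, h1 a u hu v hv, hG, eval_X]
    ring

lemma chPt_mem (a : Fin 2 × Fin N → ℂ) (e : Fin 2) : chPt Bs a e ∈ (chart Bs a).1 :=
  Submodule.subset_span ⟨e, rfl⟩

open MvPolynomial in
lemma detP_chPt (a : Fin 2 × Fin N → ℂ) :
    eval (Sum.elim (chPt Bs a 0) (chPt Bs a 1)) (detP Bs) = 1 := by
  rw [detP_eval]
  simp [chPt_repr_inl]

open MvPolynomial in
lemma chart_closed (h : MvPolynomial (Fin 2 × Fin N) ℂ) :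
    ∃ Z : Set (ProjLine (N + 1)), IsClosed Z ∧ ∀ a, chart Bs a ∈ Z ↔ eval a h = 0 := by
  obtain ⟨F, m, hF⟩ := chart_poly Bs h
  refine ⟨{W | ¬ ∀ u ∈ W.1, ∀ v ∈ W.1, eval (Sum.elim u v) F = 0}ᶜ, ?_, ?_⟩
  · rw [isClosed_compl_iff]
    exact TopologicalSpace.isOpen_generateFrom_of_mem ⟨F, rfl⟩
  · intro a
    constructor
    · intro ha
      have h1 : ∀ u ∈ (chart Bs a).1, ∀ v ∈ (chart Bs a).1, eval (Sum.elim u v) F = 0 :=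
        not_not.mp ha
      have h2 := h1 _ (chPt_mem Bs a 0) _ (chPt_mem Bs a 1)
      rw [hF a _ (chPt_mem Bs a 0) _ (chPt_mem Bs a 1), detP_chPt] at h2
      simpa using h2
    · intro ha
      refine not_not.mpr ?_
      intro u hu v hv
      rw [hF a u hu v hv, ha, mul_zero]

open MvPolynomial in
lemma chart_open : IsOpen (Set.range (chart Bs)) := by
  have : Set.range (chart Bs) =
      {W | ¬ ∀ u ∈ W.1, ∀ v ∈ W.1, eval (Sum.elim u v) (detP Bs) = 0} := by
    ext W
    constructor
    · rintro ⟨a, rfl⟩ hW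
      have := hW _ (chPt_mem Bs a 0) _ (chPt_mem Bs a 1)
      rw [detP_chPt] at this
      exact one_ne_zero this
    · intro hW
      have hW' : ¬ ∀ u ∈ W.1, ∀ v ∈ W.1, eval (Sum.elim u v) (detP Bs) = 0 := hW
      push Not at hW'
      obtain ⟨u, hu, v, hv, hne⟩ := hW'
      rw [detP_eval] at hne
      set δ := Bs.repr u (Sum.inl 0) * Bs.repr v (Sum.inl 1) -
        Bs.repr u (Sum.inl 1) * Bs.repr v (Sum.inl 0) with hδ
      let P : Fin 2 → Fin (N + 2) → ℂ :=
        ![δ⁻¹ • (Bs.repr v (Sum.inl 1) • u - Bs.repr u (Sum.inl 1) • v),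
          δ⁻¹ • (Bs.repr u (Sum.inl 0) • v - Bs.repr v (Sum.inl 0) • u)]
      have hP : ∀ e, P e ∈ W.1 := by
        intro e
        fin_cases e
        · exact W.1.smul_mem _ (W.1.sub_mem (W.1.smul_mem _ hu) (W.1.smul_mem _ hv))
        · exact W.1.smul_mem _ (W.1.sub_mem (W.1.smul_mem _ hv) (W.1.smul_mem _ hu))
      let a : Fin 2 × Fin N → ℂ := fun q => Bs.repr (P q.1) (Sum.inr q.2)
      have hpt : ∀ e, chPt Bs a e = P e := by
        intro e
        apply Bs.repr.injective
        ext j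
        rcases j with j | k
        · rw [chPt_repr_inl]
          fin_cases e <;> fin_cases j <;> simp [P] <;> field_simp <;> rw [hδ] <;> ring_nf <;> simp
        · rw [chPt_repr_inr]
      refine ⟨a, Subtype.ext ?_⟩
      refine Submodule.eq_of_le_of_finrank_eq ?_ ?_
      · change Submodule.span ℂ (Set.range (chPt Bs a)) ≤ _
        rw [Submodule.span_le]
        rintro _ ⟨e, rfl⟩
        rw [hpt]; exact hP e
      · rw [(chart Bs a).2, W.2]
  rw [this]
  exact TopologicalSpace.isOpen_generateFrom_of_mem ⟨detP Bs, rfl⟩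

open MvPolynomial in
/-- The coordinates of `chPt` as polynomials. -/
def ptP (e : Fin 2) (r : Fin (N + 2)) : MvPolynomial (Fin 2 × Fin N) ℂ :=
  C (Bs (Sum.inl e) r) + ∑ k, X (e, k) * C (Bs (Sum.inr k) r)

open MvPolynomial in
lemma ptP_eval (a : Fin 2 × Fin N → ℂ) (e : Fin 2) (r : Fin (N + 2)) :
    eval a (ptP Bs e r) = chPt Bs a e r := by
  simp [ptP, chPt]

open MvPolynomial in
lemma eval_aeval_eq {σ τ : Type} (P : τ → MvPolynomial σ ℂ) (a : σ → ℂ) (g : MvPolynomial τ ℂ) :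
    eval a (aeval P g) = eval (fun t => eval a (P t)) g := by
  have : (aeval (R := ℂ) a).comp (aeval P) = aeval (fun t => eval a (P t)) := by
    ext i; simp
  exact DFunLike.congr_fun this g

open MvPolynomial in
lemma chart_cont (V : Set (ProjLine (N + 1))) (hV : IsOpen V) : ∀ a, chart Bs a ∈ V →
    ∃ h : MvPolynomial (Fin 2 × Fin N) ℂ, eval a h ≠ 0 ∧ ∀ b, eval b h ≠ 0 → chart Bs b ∈ V := by
  induction hV with
  | basic V hV =>
    obtain ⟨F, rfl⟩ := hV
    intro a ha
    have ha' : ¬ ∀ u ∈ (chart Bs a).1, ∀ v ∈ (chart Bs a).1, eval (Sum.elim u v) F = 0 := ha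
    push Not at ha'
    obtain ⟨u, hu, v, hv, hne⟩ := ha'
    obtain ⟨c, rfl⟩ := (mem_chart Bs a u).mp hu
    obtain ⟨c', rfl⟩ := (mem_chart Bs a v).mp hv
    let Q : Fin (N + 2) ⊕ Fin (N + 2) → MvPolynomial (Fin 2 × Fin N) ℂ :=
      Sum.elim (fun r => ∑ e, C (c e) * ptP Bs e r) (fun r => ∑ e, C (c' e) * ptP Bs e r)
    have key : ∀ b, eval b (aeval Q F) =
        eval (Sum.elim (∑ e, c e • chPt Bs b e) (∑ e, c' e • chPt Bs b e)) F := by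
      intro b
      rw [eval_aeval_eq]
      congr 2
      funext t
      rcases t with t | t <;> simp [Q, ptP_eval]
    refine ⟨aeval Q F, by rwa [key], fun b hb hall => ?_⟩
    rw [key] at hb
    exact hb (hall _ ((mem_chart Bs b _).mpr ⟨c, rfl⟩) _ ((mem_chart Bs b _).mpr ⟨c', rfl⟩))
  | univ => exact fun a _ => ⟨1, by simp, fun _ _ => trivial⟩
  | inter V1 V2 _ _ h1 h2 =>
    rintro a ⟨ha1, ha2⟩
    obtain ⟨p, hp, Hp⟩ := h1 a ha1
    obtain ⟨q, hq, Hq⟩ := h2 a ha2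
    refine ⟨p * q, by rw [map_mul]; exact mul_ne_zero hp hq, fun b hb => ?_⟩
    rw [map_mul] at hb
    exact ⟨Hp b (left_ne_zero_of_mul hb), Hq b (right_ne_zero_of_mul hb)⟩
  | sUnion T _ ih =>
    rintro a ⟨V, hVT, haV⟩
    obtain ⟨p, hp, Hp⟩ := ih V hVT a haV
    exact ⟨p, hp, fun b hb => ⟨V, hVT, Hp b hb⟩⟩

open MvPolynomial in
/-- The local equations of the Fano variety of lines. -/
def fanoEq {s : ℕ} (d : Fin s → ℕ) (f : Fin s → MvPolynomial (Fin (N + 2)) ℂ)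
    (p : Σ i, Fin (d i + 1)) : MvPolynomial (Fin 2 × Fin N) ℂ :=
  aeval (fun r => ptP Bs 0 r + C ((p.2 : ℕ) : ℂ) * ptP Bs 1 r) (f p.1)

open MvPolynomial in
lemma fanoEq_eval {s : ℕ} (d : Fin s → ℕ) (f : Fin s → MvPolynomial (Fin (N + 2)) ℂ)
    (p : Σ i, Fin (d i + 1)) (a : Fin 2 × Fin N → ℂ) : eval a (fanoEq Bs d f p) =
      eval (chPt Bs a 0 + ((p.2 : ℕ) : ℂ) • chPt Bs a 1) (f p.1) := by
  rw [fanoEq, eval_aeval_eq]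
  congr 2
  funext r
  simp [ptP_eval]

end Chart

lemma exists_chart_basis {N : ℕ} (W : ProjLine (N + 1)) :
    ∃ Bs : Module.Basis (Fin 2 ⊕ Fin N) ℂ (Fin (N + 2) → ℂ), chart Bs 0 = W := by
  obtain ⟨W', hW'⟩ := Submodule.exists_isCompl W.1
  have hf : Module.finrank ℂ W' = N := by
    have h1 := Submodule.finrank_add_eq_of_isCompl hW'
    have h2 : Module.finrank ℂ W.1 = 2 := W.2
    have h3 : Module.finrank ℂ (Fin (N + 1 + 1) → ℂ) = N + 1 + 1 := by simp
    omega
  let b0 : Module.Basis (Fin 2) ℂ W.1 := Module.finBasisOfFinrankEq ℂ W.1 W.2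
  let b1 := Module.finBasisOfFinrankEq ℂ W' hf
  let Bs : Module.Basis (Fin 2 ⊕ Fin N) ℂ (Fin (N + 2) → ℂ) :=
    (b0.prod b1).map (Submodule.prodEquivOfIsCompl _ _ hW')
  refine ⟨Bs, Subtype.ext ?_⟩
  refine Submodule.eq_of_le_of_finrank_eq ?_ ?_
  · change Submodule.span ℂ (Set.range (chPt Bs 0)) ≤ _
    rw [Submodule.span_le]
    rintro _ ⟨e, rfl⟩
    have : chPt Bs 0 e = b0 e := by simp [chPt, Bs]
    rw [this]
    exact (b0 e).2
  · rw [(chart Bs 0).2, W.2]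

open MvPolynomial in
lemma fano_comp_dim (n s : ℕ) (d : Fin s → ℕ) (f : Fin s → MvPolynomial (Fin (n + 1)) ℂ)
    (X : Set (Projectivization ℂ (Fin (n + 1) → ℂ))) (hX : IsSmoothCI n s d f X)
    (C : Set (fanoLines X)) (hC : C ∈ irreducibleComponents ↥(fanoLines X)) (hne : C.Nonempty) :
    ((2 * n - ∑ i, d i - s - 2 : ℕ) : WithBot ℕ∞) ≤ topologicalKrullDim ↥C := by
  obtain ⟨c0, hc0⟩ := hne
  cases n with
  | zero =>
    exfalso
    have h1 := c0.1.2
    have h2 := Submodule.finrank_le c0.1.1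
    simp only [Module.finrank_fin_fun] at h2
    omega
  | succ N =>
    obtain ⟨Bs, hBs⟩ := exists_chart_basis c0.1
    have hcard : (Set.range (fanoEq Bs d f)).encard ≤ ((∑ i, d i + s : ℕ) : ℕ∞) := by
      rw [← Set.image_univ]
      refine (Set.encard_image_le _ _).trans ?_
      rw [Set.encard_univ, ENat.card_eq_coe_fintype_card]
      simp [Fintype.card_sigma, Finset.sum_add_distrib]
    have := chart_dim (chart Bs) (chart_open Bs) (chart_cont Bs) (chart_closed Bs) (fanoLines X)
      (Set.range (fanoEq Bs d f)) (∑ i, d i + s) hcard (by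
        intro a
        rw [mem_fano_iff hX]
        constructor
        · rintro h _ ⟨p, rfl⟩
          rw [fanoEq_eval]
          exact h _ (Submodule.add_mem _ (chPt_mem Bs a 0)
            (Submodule.smul_mem _ _ (chPt_mem Bs a 1))) _
        · intro h w hw i
          obtain ⟨c, rfl⟩ := (mem_chart Bs a w).mp hw
          rw [Fin.sum_univ_two]
          apply line_vanish (hX.homog i)
          intro j hj
          have := h _ ⟨⟨i, ⟨j, by omega⟩⟩, rfl⟩
          rwa [fanoEq_eval] at this) C hC 0 c0 hc0 hBs.symm
    convert this using 2
    simp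
    omega

/-- **Proposition (lower bound on the dimension of the Fano variety of lines).**
Every nonempty irreducible component of `F(X)` has dimension at least `2n − d − s − 2`;
moreover, if `2n − d − s − 2 ≥ 0` (i.e. `d + s + 2 ≤ 2n`), then `F(X)` is nonempty and
`dim F(X) ≥ 2n − d − s − 2`. -/
theorem fanoLines_dim_lower_bound
    (n s : ℕ) (d : Fin s → ℕ)
    (f : Fin s → MvPolynomial (Fin (n + 1)) ℂ)
    (X : Set (Projectivization ℂ (Fin (n + 1) → ℂ)))
    (hX : IsSmoothCI n s d f X) :
    (∀ C ∈ irreducibleComponents ↥(fanoLines X), C.Nonempty →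
      ((2 * n - ∑ i, d i - s - 2 : ℕ) : WithBot ℕ∞) ≤ topologicalKrullDim ↥C) ∧
    (∑ i, d i + s + 2 ≤ 2 * n →
      (fanoLines X).Nonempty ∧
      ((2 * n - ∑ i, d i - s - 2 : ℕ) : WithBot ℕ∞) ≤ topologicalKrullDim ↥(fanoLines X)) := by
  refine ⟨fano_comp_dim n s d f X hX, fun hn => ?_⟩
  have hne : (fanoLines X).Nonempty := by
    cases n with
    | zero => omega
    | succ N =>
      obtain ⟨W, hW, h⟩ := exists_line N d hX.two_le_deg (by omega) f hX.homog
      exact ⟨⟨W, hW⟩, (mem_fano_iff hX _).mpr h⟩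
  refine ⟨hne, ?_⟩
  obtain ⟨W, hW⟩ := hne
  let x : fanoLines X := ⟨W, hW⟩
  exact (fano_comp_dim n s d f X hX (irreducibleComponent x)
    (irreducibleComponent_mem_irreducibleComponents x) ⟨x, mem_irreducibleComponent⟩).trans
    (topologicalKrullDim_subspace_le _ _)

end
end

section
/- Let d_1, …, d_s ≥ 2 and d := d_1 + ⋯ + d_s with d > 2n − s − 2. Then for a general tuple (f_1,…,f_s) in ⊕_{i=1}^s Sym^{d_i}(V*) (V = ℂ^{n+1}), i.e., for all tuples in a dense Zariski-open subset, the complete intersection X = V(f_1,…,f_s) ⊂ ℙ^n contains no projective line; equivalently, F(X) is empty. -/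
/-! Formalization of: for degrees d_1,…,d_s ≥ 2 with d := Σ d_i > 2n − s − 2, a general
tuple (f_1,…,f_s) of homogeneous polynomials of these degrees cuts out X = V(f_1,…,f_s) ⊆ ℙ^n
containing no projective line, i.e. F(X) = ∅. -/

noncomputable section

/-- The common zero locus `V(f_1, …, f_s) ⊆ ℙ^n` of a tuple of polynomials. -/
def projZeroLocus {n s : ℕ} (f : Fin s → MvPolynomial (Fin (n + 1)) ℂ) :
    Set (Projectivization ℂ (Fin (n + 1) → ℂ)) :=
  {x | ∀ i, MvPolynomial.eval x.rep (f i) = 0}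

/-- `P` holds for a *general* tuple `(f_1, …, f_s)` of homogeneous polynomials of degrees
`(d_1, …, d_s)` (a general point of the parameter space `⊕_i Sym^{d_i}(V*)`, `V = ℂ^{n+1}`):
there is a polynomial condition `g` on the coefficients of the tuple which is nonzero at some
tuple of homogeneous polynomials of the given degrees (so the corresponding basic open subset
of the parameter space is nonempty, hence dense), and `P` holds at every tuple of homogeneous
polynomials of the given degrees where `g` does not vanish. -/
def GenericHolds (n : ℕ) {s : ℕ} (d : Fin s → ℕ)
    (P : (Fin s → MvPolynomial (Fin (n + 1)) ℂ) → Prop) : Prop :=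
  ∃ g : MvPolynomial (Fin s × ((Fin (n + 1)) →₀ ℕ)) ℂ,
    (∃ f₀ : Fin s → MvPolynomial (Fin (n + 1)) ℂ, (∀ i, (f₀ i).IsHomogeneous (d i)) ∧
      MvPolynomial.eval (fun p => MvPolynomial.coeff p.2 (f₀ p.1)) g ≠ 0) ∧
    (∀ f : Fin s → MvPolynomial (Fin (n + 1)) ℂ, (∀ i, (f i).IsHomogeneous (d i)) →
      MvPolynomial.eval (fun p => MvPolynomial.coeff p.2 (f p.1)) g ≠ 0 → P f)

namespace FanoAux

open MvPolynomial

theorem exists_relation {σ τ : Type} [Finite σ] [Finite τ] (h : Nat.card τ < Nat.card σ)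
    (Q : σ → MvPolynomial τ ℂ) : ∃ g : MvPolynomial σ ℂ, g ≠ 0 ∧ aeval Q g = 0 := by
  by_contra! hcon
  have hind : AlgebraicIndependent ℂ Q := by
    rw [algebraicIndependent_iff]
    intro p hp
    by_contra hne
    exact hcon p hne hp
  have h1 := hind.cardinalMk_le_trdeg
  rw [← (IsTranscendenceBasis.mvPolynomial τ ℂ).cardinalMk_eq_trdeg] at h1
  have h2 := Cardinal.toNat_le_toNat h1 (Cardinal.mk_lt_aleph0)
  exact absurd h2 (not_le.mpr h)

/-- The linear substitution `x_k ↦ x_k + a_k x_I + b_k x_J`. -/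
def sub {N : ℕ} {A : Type} [CommRing A] (I J : Fin N) (a b : Fin N → A) (k : Fin N) :
    MvPolynomial (Fin N) A :=
  X k + C (a k) * X I + C (b k) * X J

theorem sub_homog {N : ℕ} {A : Type} [CommRing A] (I J : Fin N) (a b : Fin N → A) (k : Fin N) :
    (sub I J a b k).IsHomogeneous 1 :=
  ((isHomogeneous_X _ _).add (isHomogeneous_C_mul_X _ _)).add (isHomogeneous_C_mul_X _ _)

theorem sub_inv {N : ℕ} {A : Type} [CommRing A] (I J : Fin N) (a b : Fin N → A)
    (haI : a I = 0) (haJ : a J = 0) (hbI : b I = 0) (hbJ : b J = 0) (f : MvPolynomial (Fin N) A) :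
    bind₁ (sub I J (-a) (-b)) (bind₁ (sub I J a b) f) = f := by
  rw [bind₁_bind₁]
  have : (fun i => bind₁ (sub I J (-a) (-b)) (sub I J a b i)) = X := by
    funext i
    simp [sub, haI, haJ, hbI, hbJ]
    ring
  rw [this]
  exact aeval_X_left_apply f

theorem map_sub {N : ℕ} {A B : Type} [CommRing A] [CommRing B] (φ : A →+* B) (I J : Fin N)
    (a b : Fin N → A) (f : MvPolynomial (Fin N) A) :
    map φ (bind₁ (sub I J a b) f) = bind₁ (sub I J (φ ∘ a) (φ ∘ b)) (map φ f) := by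
  rw [map_bind₁]
  congr 2
  funext i
  simp [sub]

theorem eval_bind_sub {N : ℕ} (I J : Fin N) (a b y : Fin N → ℂ) (f : MvPolynomial (Fin N) ℂ) :
    eval y (bind₁ (sub I J a b) f) = eval (fun k => y k + a k * y I + b k * y J) f := by
  have := eval₂Hom_bind₁ (RingHom.id ℂ) y (sub I J a b) f
  have h2 : eval y (bind₁ (sub I J a b) f) = eval (fun k => eval y (sub I J a b k)) f := this
  rw [h2]
  congr 2
  funext k
  simp [sub]

/-- A polynomial vanishing on the plane `x_k = 0, k ≠ I, J` has no monomials in `x_I, x_J` only. -/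
theorem coeff_eq_zero_of_plane {N : ℕ} (I J : Fin N) (h : MvPolynomial (Fin N) ℂ)
    (hv : ∀ y : Fin N → ℂ, (∀ k, k ≠ I → k ≠ J → y k = 0) → eval y h = 0)
    (m : Fin N →₀ ℕ) (hm : ∀ k, k ≠ I → k ≠ J → m k = 0) : coeff m h = 0 := by
  classical
  let φ : Fin N → MvPolynomial (Fin N) ℂ := fun k => if k = I ∨ k = J then X k else 0
  have h0 : bind₁ φ h = 0 := by
    apply MvPolynomial.funext
    intro x
    have := eval₂Hom_bind₁ (RingHom.id ℂ) x φ h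
    have h2 : eval x (bind₁ φ h) = eval (fun k => eval x (φ k)) h := this
    rw [h2, hv _ ?_, map_zero]
    intro k h1 h2
    simp [φ, h1, h2]
  have key : ∀ p : MvPolynomial (Fin N) ℂ, coeff m (bind₁ φ p) = coeff m p := by
    intro p
    induction p using MvPolynomial.induction_on' with
    | add p q hp hq => simp [hp, hq]
    | monomial u c =>
      rw [bind₁_monomial]
      by_cases hu : ∀ k, k ≠ I → k ≠ J → u k = 0
      · rw [monomial_eq, Finsupp.prod]
        congr 2
        apply Finset.prod_congr rfl
        intro k hk
        have : k = I ∨ k = J := by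
          by_contra! hcon
          exact (Finsupp.mem_support_iff.mp hk) (hu k hcon.1 hcon.2)
        simp [φ, this]
      · push Not at hu
        obtain ⟨k, h1, h2, h3⟩ := hu
        have hne : u ≠ m := fun e => h3 (e ▸ hm k h1 h2)
        rw [coeff_monomial, if_neg hne, Finset.prod_eq_zero (Finsupp.mem_support_iff.mpr h3)]
        · simp
        · simp [φ, h1, h2, h3]
  rw [← key, h0, coeff_zero]

/-- The monomials of degree `e`. -/
def mons (N e : ℕ) : Finset (Fin N →₀ ℕ) := Finset.univ.finsuppAntidiag e

theorem mem_mons {N e : ℕ} {m : Fin N →₀ ℕ} : m ∈ mons N e ↔ m.degree = e := by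
  simp [mons, Finsupp.degree_eq_sum]

theorem sum_mons {N e : ℕ} {A : Type} [CommRing A] {f : MvPolynomial (Fin N) A}
    (hf : f.IsHomogeneous e) : ∑ m ∈ mons N e, monomial m (coeff m f) = f := by
  conv_rhs => rw [f.as_sum]
  symm
  apply Finset.sum_subset
  · intro m hm
    rw [mem_mons]
    by_contra h
    exact (mem_support_iff.mp hm) (hf.coeff_eq_zero h)
  · intro m _ hm
    rw [notMem_support_iff.mp hm, monomial_zero]

theorem coeff_sum_mons {N e : ℕ} {A : Type} [CommRing A] (c : (Fin N →₀ ℕ) → A)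
    (m : Fin N →₀ ℕ) (hm : m.degree = e) :
    coeff m (∑ m ∈ mons N e, monomial m (c m)) = c m := by
  classical
  simp [coeff_sum, coeff_monomial, mem_mons, hm]

/-- Indices of the coefficients of a tuple of forms. -/
abbrev Idx (N : ℕ) {s : ℕ} (d : Fin s → ℕ) : Type :=
  {p : Fin s × (Fin N →₀ ℕ) // p.2.degree = d p.1}

instance {N s : ℕ} (d : Fin s → ℕ) : Finite (Idx N d) := by
  apply Set.Finite.to_subtype
  apply Set.Finite.subset (Finset.finite_toSet
    ((Finset.univ : Finset (Fin s)).biUnion fun i => (mons N (d i)).map ⟨Prod.mk i, Prod.mk_right_injective i⟩))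
  rintro ⟨i, m⟩ h
  have h' : m.degree = d i := h
  simpa [mem_mons] using h'

/-- Monomials only involving `x_I, x_J`. -/
def Spec {N : ℕ} (I J : Fin N) (m : Fin N →₀ ℕ) : Prop := ∀ k, k ≠ I → k ≠ J → m k = 0

theorem card_ineq {n s : ℕ} (d : Fin s → ℕ) (hgt : 2 * n < ∑ i, d i + s + 2)
    (I J : Fin (n + 1)) (hIJ : I ≠ J) :
    Nat.card ({p : Idx (n + 1) d // ¬ Spec I J p.1.2} ⊕
      ({k : Fin (n + 1) // k ≠ I ∧ k ≠ J} ⊕ {k : Fin (n + 1) // k ≠ I ∧ k ≠ J}))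
      < Nat.card (Idx (n + 1) d) := by
  classical
  have := Fintype.ofFinite (Idx (n + 1) d)
  have hT : Nat.card {k : Fin (n + 1) // k ≠ I ∧ k ≠ J} + 2 = n + 1 := by
    rw [Nat.card_eq_fintype_card, Fintype.card_subtype]
    have : (Finset.univ.filter fun k : Fin (n + 1) => k ≠ I ∧ k ≠ J) = ({I, J} : Finset _)ᶜ := by
      ext k; simp
    rw [this, ← Finset.card_pair hIJ, Finset.card_compl_add_card]
    simp
  have hS : ∑ i, (d i + 1) ≤ Nat.card {p : Idx (n + 1) d // Spec I J p.1.2} := by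
    have : ∑ i, (d i + 1) = Nat.card (Σ i, Fin (d i + 1)) := by simp
    rw [this]
    let F : (Σ i, Fin (d i + 1)) → {p : Idx (n + 1) d // Spec I J p.1.2} := fun q =>
      ⟨⟨(q.1, Finsupp.single I q.2.1 + Finsupp.single J (d q.1 - q.2.1)), by
        have := q.2.2
        simp only [map_add, Finsupp.degree_single]
        omega⟩, by
        intro k h1 h2
        simp [Finsupp.single_apply, h1.symm, h2.symm]⟩
    apply Nat.card_le_card_of_injective F
    rintro ⟨i, k⟩ ⟨i', k'⟩ h
    have h' := congrArg (fun p => p.1.1) h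
    have hi : i = i' := congrArg Prod.fst h'
    subst hi
    have h := congrArg Prod.snd h'
    simp only [F] at h
    have := DFunLike.congr_fun h I
    simp [Finsupp.single_apply, hIJ.symm] at this
    have := Fin.ext this
    rw [this]
  have hsplit : Nat.card {p : Idx (n + 1) d // Spec I J p.1.2} +
      Nat.card {p : Idx (n + 1) d // ¬ Spec I J p.1.2} = Nat.card (Idx (n + 1) d) := by
    rw [← Nat.card_sum]
    exact Nat.card_congr (Equiv.sumCompl _)
  rw [Nat.card_sum, Nat.card_sum]
  rw [Finset.sum_add_distrib] at hS
  simp only [Finset.sum_const, Finset.card_univ, Fintype.card_fin, smul_eq_mul, mul_one] at hS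
  omega

/-- The equation for tuples containing a line in the chart `(I, J)`. -/
theorem chart {n s : ℕ} (d : Fin s → ℕ) (hgt : 2 * n < ∑ i, d i + s + 2)
    (I J : Fin (n + 1)) (hIJ : I ≠ J) :
    ∃ g : MvPolynomial (Idx (n + 1) d) ℂ, g ≠ 0 ∧
      ∀ f : Fin s → MvPolynomial (Fin (n + 1)) ℂ, (∀ i, (f i).IsHomogeneous (d i)) →
      ∀ a b : Fin (n + 1) → ℂ, a I = 0 → a J = 0 → b I = 0 → b J = 0 →
      (∀ i, ∀ α β : ℂ, eval (fun k => α * (a k + if k = I then 1 else 0) +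
        β * (b k + if k = J then 1 else 0)) (f i) = 0) →
      eval (fun p : Idx (n + 1) d => coeff p.1.2 (f p.1.1)) g = 0 := by
  classical
  let T := {k : Fin (n + 1) // k ≠ I ∧ k ≠ J}
  let P := {p : Idx (n + 1) d // ¬ Spec I J p.1.2} ⊕ (T ⊕ T)
  let A := MvPolynomial P ℂ
  let a' : Fin (n + 1) → A := fun k => if h : k ≠ I ∧ k ≠ J then X (.inr (.inl ⟨k, h⟩)) else 0
  let b' : Fin (n + 1) → A := fun k => if h : k ≠ I ∧ k ≠ J then X (.inr (.inr ⟨k, h⟩)) else 0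
  let c' : Fin s → (Fin (n + 1) →₀ ℕ) → A := fun i m =>
    if h : m.degree = d i ∧ ¬ Spec I J m then X (.inl ⟨⟨(i, m), h.1⟩, h.2⟩) else 0
  let H : Fin s → MvPolynomial (Fin (n + 1)) A := fun i => ∑ m ∈ mons (n + 1) (d i), monomial m (c' i m)
  let Q : Idx (n + 1) d → A := fun p => coeff p.1.2 (bind₁ (sub I J (-a') (-b')) (H p.1.1))
  obtain ⟨g, hg, hg0⟩ := exists_relation (card_ineq d hgt I J hIJ) Q
  refine ⟨g, hg, ?_⟩
  intro f hf a b haI haJ hbI hbJ hvan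
  let h : Fin s → MvPolynomial (Fin (n + 1)) ℂ := fun i => bind₁ (sub I J a b) (f i)
  have hh : ∀ i, (h i).IsHomogeneous (d i) := by
    intro i
    have := (hf i).aeval (sub I J a b) (sub_homog I J a b)
    rwa [one_mul] at this
  have hspec : ∀ i m, Spec I J m → coeff m (h i) = 0 := by
    intro i m hm
    refine coeff_eq_zero_of_plane I J (h i) ?_ m hm
    intro y hy
    simp only [h]
    rw [eval_bind_sub, ← hvan i (y I) (y J)]
    congr 2
    funext k
    by_cases h1 : k = I
    · subst h1
      simp [haI, hbI, hIJ]
    · by_cases h2 : k = J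
      · subst h2
        simp [haJ, hbJ, h1]
      · simp [h1, h2, hy k h1 h2]
        ring
  let pt : P → ℂ := Sum.elim (fun p => coeff p.1.1.2 (h p.1.1.1))
    (Sum.elim (fun k => a k.1) (fun k => b k.1))
  have ha : (eval pt) ∘ (-a') = -a := by
    funext k
    by_cases h1 : k = I
    · subst h1; simp [a', haI]
    by_cases h2 : k = J
    · subst h2; simp [a', haJ]
    simp [a', h1, h2, pt]
  have hb : (eval pt) ∘ (-b') = -b := by
    funext k
    by_cases h1 : k = I
    · subst h1; simp [b', hbI]
    by_cases h2 : k = J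
    · subst h2; simp [b', hbJ]
    simp [b', h1, h2, pt]
  have hH : ∀ i, map (eval pt) (H i) = h i := by
    intro i
    rw [← sum_mons (hh i)]
    simp only [H, map_sum, map_monomial]
    apply Finset.sum_congr rfl
    intro m hm
    rw [mem_mons] at hm
    congr 1
    by_cases hs : Spec I J m
    · simp [c', hs, hspec i m hs]
    · simp [c', hs, hm, pt]
  have hQ : ∀ p, eval pt (Q p) = coeff p.1.2 (f p.1.1) := by
    intro p
    simp only [Q]
    rw [← coeff_map, map_sub, ha, hb, hH]
    simp only [h]
    rw [sub_inv I J a b haI haJ hbI hbJ]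
  have : eval pt (aeval Q g) = eval (fun p => eval pt (Q p)) g := by
    rw [aeval_def, ← coe_eval₂Hom, ← RingHom.comp_apply, comp_eval₂Hom]
    have hc : (eval pt).comp (algebraMap ℂ (MvPolynomial P ℂ)) = RingHom.id ℂ := by
      ext x
      simp [algebraMap_eq]
    rw [hc]
    rfl
  rw [hg0, map_zero] at this
  rw [this]
  simp only [hQ]

theorem exists_chart {N : ℕ} (W : Submodule ℂ (Fin N → ℂ)) (hW : Module.finrank ℂ W = 2) :
    ∃ I J : Fin N, I ≠ J ∧ ∃ u ∈ W, ∃ v ∈ W, u I = 1 ∧ u J = 0 ∧ v I = 0 ∧ v J = 1 := by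
  have h1 : W ≠ ⊥ := by
    rintro rfl
    simp at hW
  obtain ⟨w, hw, hw0⟩ := W.exists_mem_ne_zero_of_ne_bot h1
  obtain ⟨I, hI⟩ := Function.ne_iff.mp hw0
  have h2 : ∃ w' ∈ W, w' ∉ Submodule.span ℂ {w} := by
    by_contra! hcon
    have h3 := Submodule.finrank_mono (show W ≤ Submodule.span ℂ {w} from hcon)
    rw [hW, finrank_span_singleton hw0] at h3
    omega
  obtain ⟨w', hw', hws⟩ := h2
  have hI' : w I ≠ 0 := hI
  let v0 := w' - (w' I / w I) • w
  have hv0W : v0 ∈ W := W.sub_mem hw' (W.smul_mem _ hw)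
  have hv0 : v0 ≠ 0 := by
    intro h
    apply hws
    rw [sub_eq_zero.mp h]
    exact Submodule.smul_mem _ _ (Submodule.mem_span_singleton_self w)
  have hv0I : v0 I = 0 := by
    simp [v0, hI']
  obtain ⟨J, hJ⟩ := Function.ne_iff.mp hv0
  have hJ' : v0 J ≠ 0 := hJ
  have hIJ : I ≠ J := by
    rintro rfl
    exact hJ' hv0I
  refine ⟨I, J, hIJ, (w I)⁻¹ • (w - (w J / v0 J) • v0),
    W.smul_mem _ (W.sub_mem hw (W.smul_mem _ hv0W)), (v0 J)⁻¹ • v0, W.smul_mem _ hv0W, ?_, ?_, ?_, ?_⟩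
  · simp [hv0I, hI']
  · simp [hJ']
  · simp [hv0I]
  · simp [hJ']

theorem eval_zero_of_line {n s : ℕ} (d : Fin s → ℕ) (hd : ∀ i, 2 ≤ d i)
    (f : Fin s → MvPolynomial (Fin (n + 1)) ℂ) (hf : ∀ i, (f i).IsHomogeneous (d i))
    (W : Submodule ℂ (Fin (n + 1) → ℂ)) (hW : lineSet W ⊆ projZeroLocus f) (i : Fin s)
    (x : Fin (n + 1) → ℂ) (hx : x ∈ W) : eval x (f i) = 0 := by
  have hsm : ∀ (t : ℂ) (y : Fin (n + 1) → ℂ), eval (t • y) (f i) = t ^ d i * eval y (f i) := by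
    intro t y
    rw [eval_eq, eval_eq, Finset.mul_sum]
    apply Finset.sum_congr rfl
    intro m hm
    have hdeg : m.degree = d i := by
      by_contra h
      exact (mem_support_iff.mp hm) ((hf i).coeff_eq_zero h)
    simp only [Pi.smul_apply, smul_eq_mul, mul_pow, Finset.prod_mul_distrib]
    rw [Finset.prod_pow_eq_pow_sum]
    rw [Finsupp.degree_apply] at hdeg
    rw [hdeg]
    ring
  by_cases h0 : x = 0
  · have := hsm 0 0
    rw [zero_smul, zero_pow (by have := hd i; omega), zero_mul] at this
    rw [h0, this]
  · obtain ⟨t, ht⟩ := Projectivization.exists_smul_eq_mk_rep ℂ x h0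
    have hmem : Projectivization.mk ℂ x h0 ∈ lineSet W := by
      change (Projectivization.mk ℂ x h0).rep ∈ W
      rw [← ht]
      exact W.smul_mem (t : ℂ) hx
    have h3 : eval (Projectivization.mk ℂ x h0).rep (f i) = 0 := hW hmem i
    rw [← ht] at h3
    have h4 := hsm (t : ℂ) x
    have h5 : ((t : ℂ) • x) = t • x := rfl
    rw [h5, h3] at h4
    rcases mul_eq_zero.mp h4.symm with h | h
    · exact absurd h (pow_ne_zero _ t.ne_zero)
    · exact h

end FanoAux

open FanoAux MvPolynomial in
/-- **Proposition.**  If `d_i ≥ 2` for all `i` and `d := Σ d_i > 2n − s − 2`, then for a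
general tuple `(f_1, …, f_s)` in `⊕_i Sym^{d_i}(V*)`, the variety `X = V(f_1, …, f_s) ⊆ ℙ^n`
contains no projective line: its Fano variety of lines is empty. -/
theorem fanoLines_empty_of_general
    (n s : ℕ) (d : Fin s → ℕ) (hd : ∀ i, 2 ≤ d i)
    (hgt : 2 * n < ∑ i, d i + s + 2) :
    GenericHolds n d (fun f => fanoLines (projZeroLocus f) = ∅) := by
  classical
  have hch : ∀ q : {q : Fin (n + 1) × Fin (n + 1) // q.1 ≠ q.2}, _ :=
    fun q => chart d hgt q.1.1 q.1.2 q.2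
  choose G hG0 hG using hch
  let g : MvPolynomial (Idx (n + 1) d) ℂ := ∏ q, G q
  have hg : g ≠ 0 := Finset.prod_ne_zero_iff.mpr fun q _ => hG0 q
  refine ⟨rename Subtype.val g, ?_, ?_⟩
  · have : ∃ c, eval c g ≠ 0 := by
      by_contra! hcon
      exact hg (MvPolynomial.funext fun x => by rw [hcon x, map_zero])
    obtain ⟨c, hc⟩ := this
    refine ⟨fun i => ∑ m ∈ mons (n + 1) (d i), monomial m
      (if h : m.degree = d i then c ⟨(i, m), h⟩ else 0), ?_, ?_⟩
    · intro i
      apply IsHomogeneous.sum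
      intro m hm
      exact isHomogeneous_monomial _ (mem_mons.mp hm)
    · rw [eval_rename]
      have hfun : ((fun p : Fin s × (Fin (n + 1) →₀ ℕ) => coeff p.2
          (∑ m ∈ mons (n + 1) (d p.1), monomial m
            (if h : m.degree = d p.1 then c ⟨(p.1, m), h⟩ else 0))) ∘
          (Subtype.val : Idx (n + 1) d → _)) = c := by
        funext p
        obtain ⟨⟨i, m⟩, h⟩ := p
        simp only [Function.comp]
        rw [coeff_sum_mons _ m h, dif_pos h]
      rw [hfun]
      exact hc
  · intro f hf hne
    rw [eval_rename] at hne
    rw [Set.eq_empty_iff_forall_notMem]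
    rintro ⟨W, hW⟩ hline
    apply hne
    obtain ⟨I, J, hIJ, u, hu, v, hv, huI, huJ, hvI, hvJ⟩ := exists_chart W hW
    simp only [g, map_prod]
    apply Finset.prod_eq_zero (Finset.mem_univ ⟨(I, J), hIJ⟩)
    refine hG ⟨(I, J), hIJ⟩ f hf (fun k => u k - if k = I then 1 else 0)
      (fun k => v k - if k = J then 1 else 0) ?_ ?_ ?_ ?_ ?_
    · simp [huI]
    · simp [huJ, hIJ.symm]
    · simp [hvI, hIJ]
    · simp [hvJ]
    · intro i α β
      have := eval_zero_of_line d hd f hf W hline i (α • u + β • v)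
        (W.add_mem (W.smul_mem _ hu) (W.smul_mem _ hv))
      convert this using 3
      funext k
      simp

end
end
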